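/- For every ε > 0, with high probability the graph G_m of the König process with m = ⌈(1 + ε) n log n⌉ contains a perfect matching. -/

import Mathlib

open scoped Classical

noncomputable section

/-- `M` is a matching in the graph `G`: a set of edges of `G` that are pairwise disjoint. -/
def IsMatchingOn {n : ℕ} (G : SimpleGraph (Fin n)) (M : Finset (Sym2 (Fin n))) : Prop :=
  (∀ e ∈ M, e ∈ G.edgeSet) ∧
  ∀ e ∈ M, ∀ f ∈ M, e ≠ f → ∀ v : Fin n, v ∈ e → v ∉ f

/-- ν(G): the maximum size of a matching of `G`. -/
def matchNum {n : ℕ} (G : SimpleGraph (Fin n)) : ℕ :=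
  sSup {k | ∃ M : Finset (Sym2 (Fin n)), IsMatchingOn G M ∧ M.card = k}

/-- `C` is a vertex cover of `G`. -/
def IsVertexCover {n : ℕ} (G : SimpleGraph (Fin n)) (C : Finset (Fin n)) : Prop :=
  ∀ e ∈ G.edgeSet, ∃ v ∈ C, v ∈ e

/-- τ(G): the minimum size of a vertex cover of `G`. -/
def coverNum {n : ℕ} (G : SimpleGraph (Fin n)) : ℕ :=
  sInf {k | ∃ C : Finset (Fin n), IsVertexCover G C ∧ C.card = k}

/-- `G` is a König graph: ν(G) = τ(G). -/
def IsKonig {n : ℕ} (G : SimpleGraph (Fin n)) : Prop := matchNum G = coverNum G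

/-- An ordering `e_1, …, e_N` (0-indexed: `σ 0, …, σ (N-1)`) of the `N = n(n-1)/2` edges of
the complete graph on `Fin n`: an injective function from `Fin N` to non-diagonal elements
of `Sym2 (Fin n)`, hence a bijection onto the edge set of `K_n`. -/
def EdgeOrdering (n : ℕ) : Type :=
  {σ : Fin (n*(n-1)/2) → Sym2 (Fin n) // Function.Injective σ ∧ ∀ i, ¬ (σ i).IsDiag}

/-- The König process: `KonigProc σ m` is the graph `G_m`, where `G_0 = ⊥` and
`G_{m+1} = G_m + e_{m+1}` if that graph is König, `G_{m+1} = G_m` otherwise. -/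
def KonigProc {n : ℕ} (σ : EdgeOrdering n) : ℕ → SimpleGraph (Fin n)
  | 0 => ⊥
  | m+1 =>
    if h : m < n*(n-1)/2 then
      (if IsKonig (KonigProc σ m ⊔ SimpleGraph.fromEdgeSet {σ.1 ⟨m, h⟩})
        then KonigProc σ m ⊔ SimpleGraph.fromEdgeSet {σ.1 ⟨m, h⟩}
        else KonigProc σ m)
    else KonigProc σ m

/-- The probability of an event `A` under the uniformly random edge ordering. -/
def Pr (n : ℕ) (A : EdgeOrdering n → Prop) : ℝ :=
  (Nat.card {σ : EdgeOrdering n // A σ} : ℝ) / (Nat.card (EdgeOrdering n) : ℝ)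

/-! ### The uniform random edge ordering -/

instance EdgeOrdering.instFintype (n : ℕ) : Fintype (EdgeOrdering n) := by
  unfold EdgeOrdering
  infer_instance

/-- Exchanging two positions of an edge ordering. -/
def EdgeOrdering.swap {n : ℕ} (σ : EdgeOrdering n) (i j : Fin (n*(n-1)/2)) : EdgeOrdering n :=
  ⟨σ.1 ∘ Equiv.swap i j, σ.2.1.comp (Equiv.injective _), fun _ => σ.2.2 _⟩

/-- The two orderings have the same first `t` edges. -/
def EdgeOrdering.Agree {n : ℕ} (t : ℕ) (σ τ : EdgeOrdering n) : Prop :=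
  ∀ i : Fin (n*(n-1)/2), i.1 < t → σ.1 i = τ.1 i

/-- The edge at position `t` of the ordering belongs to `S`. -/
def EdgeOrdering.Hit {n : ℕ} (σ : EdgeOrdering n) (t : ℕ) (S : Finset (Sym2 (Fin n))) : Prop :=
  ∃ h : t < n*(n-1)/2, σ.1 ⟨t, h⟩ ∈ S

/-- The number of times `t ∈ [a, b)` at which the edge at position `t` belongs to the set `A t σ`. -/
def hits {n : ℕ} (A : ℕ → EdgeOrdering n → Finset (Sym2 (Fin n))) (a b : ℕ)
    (σ : EdgeOrdering n) : ℕ :=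
  ((Finset.Ico a b).filter fun t => σ.Hit t (A t σ)).card

/-- The edges of `S` that are not among the first `t` edges of the ordering. -/
def remaining {n : ℕ} (σ : EdgeOrdering n) (t : ℕ) (S : Finset (Sym2 (Fin n))) :
    Finset (Fin (n*(n-1)/2)) :=
  Finset.univ.filter fun j => t ≤ j.1 ∧ σ.1 j ∈ S

theorem EdgeOrdering.swap_swap {n : ℕ} (σ : EdgeOrdering n) (i j : Fin (n*(n-1)/2)) :
    (σ.swap i j).swap i j = σ := by
  apply Subtype.ext
  funext x
  simp [EdgeOrdering.swap]

theorem EdgeOrdering.sum_swap {n : ℕ} (f : EdgeOrdering n → ℝ) (i j : Fin (n*(n-1)/2)) :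
    ∑ σ : EdgeOrdering n, f (σ.swap i j) = ∑ σ, f σ :=
  Equiv.sum_comp
    (⟨fun σ => σ.swap i j, fun σ => σ.swap i j, fun σ => σ.swap_swap i j,
      fun σ => σ.swap_swap i j⟩ : EdgeOrdering n ≃ EdgeOrdering n) f

theorem EdgeOrdering.agree_swap {n : ℕ} (σ : EdgeOrdering n) {i j : Fin (n*(n-1)/2)}
    (h : i ≤ j) : EdgeOrdering.Agree i.1 (σ.swap i j) σ := by
  intro x hx
  have h1 : x ≠ i := fun h => by simp [h] at hx
  have h2 : x ≠ j := fun h' => by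
    subst h'
    exact absurd (Fin.le_def.1 h) (by omega)
  simp [EdgeOrdering.swap, Equiv.swap_apply_of_ne_of_ne h1 h2]

theorem EdgeOrdering.Agree.mono {n s t : ℕ} {σ τ : EdgeOrdering n}
    (h : EdgeOrdering.Agree t σ τ) (hst : s ≤ t) : EdgeOrdering.Agree s σ τ :=
  fun i hi => h i (hi.trans_le hst)

theorem EdgeOrdering.Agree.hit_iff {n s t : ℕ} {σ τ : EdgeOrdering n}
    (h : EdgeOrdering.Agree t σ τ) (hst : s < t) (S : Finset (Sym2 (Fin n))) :
    σ.Hit s S ↔ τ.Hit s S := by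
  unfold EdgeOrdering.Hit
  refine exists_congr fun hs => ?_
  rw [h ⟨s, hs⟩ hst]

theorem hits_congr {n : ℕ} {A : ℕ → EdgeOrdering n → Finset (Sym2 (Fin n))}
    (hA : ∀ t σ τ, EdgeOrdering.Agree t σ τ → A t σ = A t τ) {a b : ℕ} {σ τ : EdgeOrdering n}
    (h : EdgeOrdering.Agree b σ τ) : hits A a b σ = hits A a b τ := by
  unfold hits
  congr 1
  refine Finset.filter_congr fun t ht => ?_
  have ht' := (Finset.mem_Ico.1 ht).2
  rw [hA t σ τ (h.mono ht'.le), h.hit_iff ht']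

theorem hits_succ {n : ℕ} (A : ℕ → EdgeOrdering n → Finset (Sym2 (Fin n))) {a b : ℕ}
    (hab : a ≤ b) (σ : EdgeOrdering n) :
    hits A a (b + 1) σ = hits A a b σ + if σ.Hit b (A b σ) then 1 else 0 := by
  unfold hits
  rw [← Finset.insert_Ico_right_eq_Ico_add_one hab, Finset.filter_insert]
  split_ifs with h
  · rw [Finset.card_insert_of_notMem (by simp)]
  · simp

theorem sum_exp_hit_swap {n : ℕ} (lam p : ℝ) (S : Finset (Sym2 (Fin n))) {t : ℕ}
    (ht : t < n*(n-1)/2) (σ : EdgeOrdering n)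
    (hp : (Real.exp lam - 1) * (remaining σ t S).card ≤
      (Real.exp lam - 1) * (p * ((n*(n-1)/2 : ℕ) - t : ℝ))) :
    ∑ j ∈ Finset.Ici (⟨t, ht⟩ : Fin (n*(n-1)/2)),
        Real.exp (lam * if (σ.swap ⟨t, ht⟩ j).Hit t S then 1 else 0) ≤
      ((n*(n-1)/2 : ℕ) - t : ℝ) * Real.exp ((Real.exp lam - 1) * p) := by
  have hcard : ((Finset.Ici (⟨t, ht⟩ : Fin (n*(n-1)/2))).card : ℝ)
      = ((n*(n-1)/2 : ℕ) - t : ℝ) := by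
    rw [Fin.card_Ici, Nat.cast_sub ht.le]
  have key : ∀ j ∈ Finset.Ici (⟨t, ht⟩ : Fin (n*(n-1)/2)),
      Real.exp (lam * if (σ.swap ⟨t, ht⟩ j).Hit t S then 1 else 0) =
        1 + (Real.exp lam - 1) * (if σ.1 j ∈ S then 1 else 0) := by
    intro j _
    have : (σ.swap ⟨t, ht⟩ j).Hit t S ↔ σ.1 j ∈ S := by
      simp [EdgeOrdering.Hit, EdgeOrdering.swap, ht]
    simp only [this]
    split_ifs <;> simp
  rw [Finset.sum_congr rfl key, Finset.sum_add_distrib, ← Finset.mul_sum]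
  have hrem : ∑ j ∈ Finset.Ici (⟨t, ht⟩ : Fin (n*(n-1)/2)), (if σ.1 j ∈ S then (1:ℝ) else 0) =
      (remaining σ t S).card := by
    rw [Finset.sum_boole]
    congr 2
    ext j
    simp [remaining, Fin.le_def]
  rw [hrem, Finset.sum_const, nsmul_eq_mul, hcard, mul_one]
  have hpos : (0:ℝ) ≤ ((n*(n-1)/2 : ℕ) - t : ℝ) := by
    rw [← hcard]; positivity
  have := Real.add_one_le_exp ((Real.exp lam - 1) * p)
  nlinarith

/-- An exponential moment bound for the number of hits of adaptively chosen sets. -/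
theorem sum_exp_hits_le {n : ℕ} (lam p : ℝ) {A : ℕ → EdgeOrdering n → Finset (Sym2 (Fin n))}
    (hA : ∀ t σ τ, EdgeOrdering.Agree t σ τ → A t σ = A t τ) {a b : ℕ} (hab : a ≤ b)
    (hb : b ≤ n*(n-1)/2)
    (hp : ∀ t σ, a ≤ t → t < b → (Real.exp lam - 1) * (remaining σ t (A t σ)).card ≤
      (Real.exp lam - 1) * (p * ((n*(n-1)/2 : ℕ) - t : ℝ))) :
    ∑ σ, Real.exp (lam * hits A a b σ) ≤
      Real.exp ((Real.exp lam - 1) * p * (b - a)) * Fintype.card (EdgeOrdering n) := by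
  induction b, hab using Nat.le_induction with
  | base => simp [hits]
  | succ b hab ih =>
    have hbN : b < n*(n-1)/2 := hb
    have ih' := ih hbN.le fun t σ h1 h2 => hp t σ h1 (h2.trans (Nat.lt_succ_self b))
    set i : Fin (n*(n-1)/2) := ⟨b, hbN⟩ with hi
    have hpos : (0:ℝ) < ((n*(n-1)/2 : ℕ) - b : ℝ) := by
      rw [sub_pos]; exact_mod_cast hbN
    have hcard : ((Finset.Ici i).card : ℝ) = ((n*(n-1)/2 : ℕ) - b : ℝ) := by
      rw [Fin.card_Ici, Nat.cast_sub hbN.le]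
    set W : EdgeOrdering n → ℝ := fun σ =>
      Real.exp (lam * if σ.Hit b (A b σ) then 1 else 0) with hW
    set P : EdgeOrdering n → ℝ := fun σ => Real.exp (lam * hits A a b σ) with hP
    have hsplit : ∀ σ, Real.exp (lam * hits A a (b+1) σ) = P σ * W σ := by
      intro σ
      rw [hits_succ A hab, hP, hW]
      simp only
      rw [← Real.exp_add, ← mul_add]
      push_cast
      rfl
    have havg : ((n*(n-1)/2 : ℕ) - b : ℝ) * ∑ σ, P σ * W σ =
        ∑ σ, P σ * ∑ j ∈ Finset.Ici i, Real.exp (lam * if (σ.swap i j).Hit b (A b σ) then 1 else 0) := by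
      rw [← hcard, ← nsmul_eq_mul, ← Finset.sum_const]
      simp_rw [Finset.mul_sum]
      conv_rhs => rw [Finset.sum_comm]
      refine Finset.sum_congr rfl fun j hj => ?_
      rw [← EdgeOrdering.sum_swap _ i j]
      refine Finset.sum_congr rfl fun σ _ => ?_
      have hag := σ.agree_swap (Finset.mem_Ici.1 hj)
      simp only [hP, hW]
      rw [hits_congr hA hag, hA b _ _ hag]
    have hbound : ((n*(n-1)/2 : ℕ) - b : ℝ) * ∑ σ, P σ * W σ ≤
        ((n*(n-1)/2 : ℕ) - b : ℝ) * (Real.exp ((Real.exp lam - 1) * p) * ∑ σ, P σ) := by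
      rw [havg, Finset.mul_sum, Finset.mul_sum]
      refine Finset.sum_le_sum fun σ _ => ?_
      have := sum_exp_hit_swap lam p (A b σ) hbN σ (hp b σ hab (Nat.lt_succ_self b))
      have hP0 : 0 ≤ P σ := (Real.exp_pos _).le
      calc _ ≤ P σ * _ := mul_le_mul_of_nonneg_left this hP0
        _ = _ := by ring
    have h2 := le_of_mul_le_mul_left hbound hpos
    rw [Finset.sum_congr rfl fun σ _ => hsplit σ]
    refine h2.trans ?_
    calc _ ≤ Real.exp ((Real.exp lam - 1) * p) * _ :=
          mul_le_mul_of_nonneg_left ih' (Real.exp_pos _).le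
      _ = _ := by
          rw [← mul_assoc, ← Real.exp_add]
          push_cast
          ring_nf

theorem Pr_eq_card_filter {n : ℕ} (E : EdgeOrdering n → Prop) :
    Pr n E = ((Finset.univ.filter E).card : ℝ) / Fintype.card (EdgeOrdering n) := by
  unfold Pr
  rw [Nat.card_eq_fintype_card, Nat.card_eq_fintype_card, Fintype.card_subtype]

theorem Pr_mono {n : ℕ} {E F : EdgeOrdering n → Prop} (h : ∀ σ, E σ → F σ) : Pr n E ≤ Pr n F := by
  rw [Pr_eq_card_filter, Pr_eq_card_filter]
  gcongr with σ
  exact h σ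

theorem Pr_or_le {n : ℕ} (E F : EdgeOrdering n → Prop) :
    Pr n (fun σ => E σ ∨ F σ) ≤ Pr n E + Pr n F := by
  simp only [Pr_eq_card_filter]
  rw [← add_div]
  gcongr
  norm_cast
  refine le_trans (Finset.card_le_card fun σ hσ => ?_) (Finset.card_union_le _ _)
  simpa using hσ

theorem Pr_exists_le {n : ℕ} {ι : Type*} (s : Finset ι) (E : ι → EdgeOrdering n → Prop) :
    Pr n (fun σ => ∃ i ∈ s, E i σ) ≤ ∑ i ∈ s, Pr n (E i) := by
  induction s using Finset.induction_on with
  | empty => simp [Pr_eq_card_filter]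
  | insert i s his ih =>
    rw [Finset.sum_insert his]
    refine le_trans (Pr_mono (F := fun σ => E i σ ∨ ∃ j ∈ s, E j σ) ?_)
      ((Pr_or_le _ _).trans (by gcongr))
    intro σ h
    simpa using h

/-- Chernoff-type bound for the number of hits of adaptively chosen sets. -/
theorem Pr_hits_le {n : ℕ} (lam p q : ℝ) {A : ℕ → EdgeOrdering n → Finset (Sym2 (Fin n))}
    (hA : ∀ t σ τ, EdgeOrdering.Agree t σ τ → A t σ = A t τ) {a b : ℕ} (hab : a ≤ b)
    (hb : b ≤ n*(n-1)/2)
    (hp : ∀ t σ, a ≤ t → t < b → (Real.exp lam - 1) * (remaining σ t (A t σ)).card ≤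
      (Real.exp lam - 1) * (p * ((n*(n-1)/2 : ℕ) - t : ℝ))) :
    Pr n (fun σ => lam * q ≤ lam * hits A a b σ) ≤
      Real.exp (-(lam * q) + (Real.exp lam - 1) * p * (b - a)) := by
  rw [Pr_eq_card_filter]
  refine div_le_of_le_mul₀ (by positivity) (Real.exp_pos _).le ?_
  have h1 := sum_exp_hits_le lam p hA hab hb hp
  have h2 : ((Finset.univ.filter fun σ : EdgeOrdering n => lam * q ≤ lam * hits A a b σ).card : ℝ)
      * Real.exp (lam * q) ≤ ∑ σ, Real.exp (lam * hits A a b σ) := by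
    rw [← nsmul_eq_mul, ← Finset.sum_const]
    refine le_trans (Finset.sum_le_sum (g := fun σ => Real.exp (lam * hits A a b σ)) ?_)
      (Finset.sum_le_sum_of_subset_of_nonneg (Finset.filter_subset _ _)
        fun _ _ _ => (Real.exp_pos _).le)
    intro σ hσ
    exact Real.exp_le_exp.2 (Finset.mem_filter.1 hσ).2
  have h3 := h2.trans h1
  rw [Real.exp_add, Real.exp_neg, mul_assoc, inv_mul_eq_div, le_div_iff₀ (Real.exp_pos _)]
  exact h3

theorem card_nondiag (n : ℕ) :
    (Finset.univ.filter fun e : Sym2 (Fin n) => ¬ e.IsDiag).card = n*(n-1)/2 := by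
  have := Sym2.card_subtype_not_diag (α := Fin n)
  rw [Fintype.card_fin, Nat.choose_two_right, Fintype.card_subtype] at this
  convert this

instance EdgeOrdering.instNonempty (n : ℕ) : Nonempty (EdgeOrdering n) := by
  have e := (Finset.univ.filter fun e : Sym2 (Fin n) => ¬ e.IsDiag).equivFinOfCardEq
    (card_nondiag n)
  refine ⟨⟨fun i => (e.symm i).1, ?_, fun i => ?_⟩⟩
  · exact Subtype.val_injective.comp e.symm.injective
  · exact (Finset.mem_filter.1 (e.symm i).2).2

theorem EdgeOrdering.exists_eq {n : ℕ} (σ : EdgeOrdering n) {e : Sym2 (Fin n)} (he : ¬ e.IsDiag) :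
    ∃ i, σ.1 i = e := by
  have h : Finset.univ.image σ.1 = Finset.univ.filter fun e : Sym2 (Fin n) => ¬ e.IsDiag := by
    apply Finset.eq_of_subset_of_card_le
    · intro e he
      obtain ⟨i, _, rfl⟩ := Finset.mem_image.1 he
      simpa using σ.2.2 i
    · rw [Finset.card_image_of_injective _ σ.2.1, card_nondiag]
      simp
  have : e ∈ Finset.univ.image σ.1 := by rw [h]; simpa using he
  simpa using this

theorem card_remaining_le {n : ℕ} (σ : EdgeOrdering n) (t : ℕ) (S : Finset (Sym2 (Fin n))) :
    (remaining σ t S).card ≤ S.card :=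
  Finset.card_le_card_of_injOn σ.1 (fun _ hj => (Finset.mem_filter.1 hj).2.2)
    (σ.2.1.injOn)

theorem card_le_remaining_add {n : ℕ} (σ : EdgeOrdering n) (t : ℕ) {S : Finset (Sym2 (Fin n))}
    (hS : ∀ e ∈ S, ¬ e.IsDiag) :
    S.card ≤ (remaining σ t S).card + hits (fun _ _ => S) 0 t σ := by
  have h1 : S ⊆ (remaining σ t S).image σ.1 ∪
      (Finset.univ.filter fun i : Fin (n*(n-1)/2) => i.1 < t ∧ σ.1 i ∈ S).image σ.1 := by
    intro e he
    obtain ⟨i, rfl⟩ := σ.exists_eq (hS e he)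
    rcases lt_or_ge i.1 t with h | h
    · exact Finset.mem_union_right _ (Finset.mem_image_of_mem _ (by simp [h, he]))
    · exact Finset.mem_union_left _ (Finset.mem_image_of_mem _ (by simp [remaining, h, he]))
  refine (Finset.card_le_card h1).trans ((Finset.card_union_le _ _).trans ?_)
  refine add_le_add Finset.card_image_le (Finset.card_image_le.trans ?_)
  refine Finset.card_le_card_of_injOn (fun i => i.1) ?_ Fin.val_injective.injOn
  intro i hi
  have hi' := (Finset.mem_filter.1 (Finset.mem_coe.1 hi)).2
  simp only [Finset.coe_filter, Finset.mem_Ico, Set.mem_ofPred_eq, zero_le, true_and]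
  exact ⟨hi'.1, i.2, hi'.2⟩

theorem hits_le {n : ℕ} (A : ℕ → EdgeOrdering n → Finset (Sym2 (Fin n))) (a b : ℕ)
    (σ : EdgeOrdering n) : hits A a b σ ≤ b - a :=
  (Finset.card_filter_le _ _).trans (by simp)

theorem hits_mono {n : ℕ} {A B : ℕ → EdgeOrdering n → Finset (Sym2 (Fin n))} {a b c d : ℕ}
    {σ : EdgeOrdering n} (hca : c ≤ a) (hbd : b ≤ d) (h : ∀ t, a ≤ t → t < b → A t σ ⊆ B t σ) :
    hits A a b σ ≤ hits B c d σ := by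
  refine Finset.card_le_card fun t ht => ?_
  obtain ⟨h1, h2, h3⟩ := Finset.mem_filter.1 ht
  obtain ⟨h4, h5⟩ := Finset.mem_Ico.1 h1
  exact Finset.mem_filter.2 ⟨Finset.mem_Ico.2 ⟨hca.trans h4, h5.trans_le hbd⟩, h2, h t h4 h5 h3⟩

/-! ### Matchings, vertex covers and König graphs -/

theorem IsMatchingOn.card_le_cover {n : ℕ} {G : SimpleGraph (Fin n)}
    {M : Finset (Sym2 (Fin n))} {C : Finset (Fin n)} (hM : IsMatchingOn G M)
    (hC : IsVertexCover G C) : M.card ≤ C.card := by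
  have h : ∀ e : Sym2 (Fin n), ∃ v : Fin n, e ∈ M → v ∈ C ∧ v ∈ e := by
    intro e
    by_cases he : e ∈ M
    · obtain ⟨v, h1, h2⟩ := hC e (hM.1 e he)
      exact ⟨v, fun _ => ⟨h1, h2⟩⟩
    · induction e with
      | _ x y => exact ⟨x, fun h => absurd h he⟩
  choose g hg using h
  refine Finset.card_le_card_of_injOn g (fun e he => (hg e he).1) ?_
  intro e he f hf hef
  by_contra hne
  exact hM.2 e he f hf hne (g e) (hg e he).2 (hef ▸ (hg f hf).2)

theorem isVertexCover_univ {n : ℕ} (G : SimpleGraph (Fin n)) : IsVertexCover G Finset.univ := by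
  intro e _
  induction e with
  | _ x y => exact ⟨x, Finset.mem_univ _, Sym2.mem_mk_left x y⟩

theorem bddAbove_matching {n : ℕ} (G : SimpleGraph (Fin n)) :
    BddAbove {k | ∃ M : Finset (Sym2 (Fin n)), IsMatchingOn G M ∧ M.card = k} := by
  refine ⟨(Finset.univ : Finset (Fin n)).card, ?_⟩
  rintro k ⟨M, hM, rfl⟩
  exact hM.card_le_cover (isVertexCover_univ G)

theorem IsMatchingOn.card_le_matchNum {n : ℕ} {G : SimpleGraph (Fin n)}
    {M : Finset (Sym2 (Fin n))} (hM : IsMatchingOn G M) : M.card ≤ matchNum G :=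
  le_csSup (bddAbove_matching G) ⟨M, hM, rfl⟩

theorem exists_matching_card_eq {n : ℕ} (G : SimpleGraph (Fin n)) :
    ∃ M, IsMatchingOn G M ∧ M.card = matchNum G :=
  Nat.sSup_mem (s := {k | ∃ M : Finset (Sym2 (Fin n)), IsMatchingOn G M ∧ M.card = k})
    ⟨0, ∅, by simp [IsMatchingOn], rfl⟩ (bddAbove_matching G)

theorem exists_cover_card_eq {n : ℕ} (G : SimpleGraph (Fin n)) :
    ∃ C, IsVertexCover G C ∧ C.card = coverNum G :=
  Nat.sInf_mem (s := {k | ∃ C : Finset (Fin n), IsVertexCover G C ∧ C.card = k})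
    ⟨_, Finset.univ, isVertexCover_univ G, rfl⟩

theorem isKonig_of_card_le {n : ℕ} {G : SimpleGraph (Fin n)} {M : Finset (Sym2 (Fin n))}
    {C : Finset (Fin n)} (hM : IsMatchingOn G M) (hC : IsVertexCover G C)
    (h : C.card ≤ M.card) : IsKonig G := by
  obtain ⟨M', hM', e1⟩ := exists_matching_card_eq G
  obtain ⟨C', hC', e2⟩ := exists_cover_card_eq G
  have h1 := hM'.card_le_cover hC'
  have h2 : coverNum G ≤ C.card := Nat.sInf_le ⟨C, hC, rfl⟩
  have h3 := hM.card_le_matchNum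
  unfold IsKonig
  omega

theorem IsMatchingOn.card_biUnion_toFinset {n : ℕ} {G : SimpleGraph (Fin n)}
    {M : Finset (Sym2 (Fin n))} (hM : IsMatchingOn G M) :
    (M.biUnion fun e => e.toFinset).card = 2 * M.card := by
  rw [Finset.card_biUnion]
  · rw [Finset.sum_congr rfl fun e he => Sym2.card_toFinset_of_not_isDiag e
      (G.not_isDiag_of_mem_edgeSet (hM.1 e he)), Finset.sum_const, smul_eq_mul, mul_comm]
  · intro e he f hf hef
    refine Finset.disjoint_left.2 fun v hv hv' => ?_
    rw [Sym2.mem_toFinset] at hv hv'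
    exact hM.2 e he f hf hef v hv hv'

theorem two_mul_matchNum_le {n : ℕ} (G : SimpleGraph (Fin n)) : 2 * matchNum G ≤ n := by
  obtain ⟨M, hM, e⟩ := exists_matching_card_eq G
  rw [← e, ← hM.card_biUnion_toFinset]
  exact (Finset.card_le_univ _).trans (by simp)

theorem exists_perfect_of_le_matchNum {n : ℕ} {G : SimpleGraph (Fin n)}
    (h : n ≤ 2 * matchNum G) : ∃ M, IsMatchingOn G M ∧ ∀ v, ∃ f ∈ M, v ∈ f := by
  obtain ⟨M, hM, e⟩ := exists_matching_card_eq G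
  refine ⟨M, hM, fun v => ?_⟩
  have : (M.biUnion fun e => e.toFinset) = Finset.univ := by
    apply Finset.eq_univ_of_card
    rw [hM.card_biUnion_toFinset, e, Fintype.card_fin]
    exact le_antisymm (two_mul_matchNum_le G) h
  have hv : v ∈ (M.biUnion fun e => e.toFinset) := by rw [this]; exact Finset.mem_univ v
  obtain ⟨f, hf, hvf⟩ := Finset.mem_biUnion.1 hv
  exact ⟨f, hf, Sym2.mem_toFinset.1 hvf⟩

/-- `f` matches the finite set `C` into `J` along edges of `G`. -/
def MatchesInto {n : ℕ} (G : SimpleGraph (Fin n)) (C J : Finset (Fin n)) (f : Fin n → Fin n) :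
    Prop :=
  Set.InjOn f C ∧ ∀ c ∈ C, f c ∈ J ∧ G.Adj c (f c)

/-- `C` is a vertex cover of `G` that can be matched into its complement. -/
def IsMatchedCover {n : ℕ} (G : SimpleGraph (Fin n)) (C : Finset (Fin n)) : Prop :=
  IsVertexCover G C ∧ ∃ f, MatchesInto G C Cᶜ f

theorem IsKonig.exists_isMatchedCover {n : ℕ} {G : SimpleGraph (Fin n)} (hG : IsKonig G) :
    ∃ C, IsMatchedCover G C := by
  obtain ⟨M, hM, e1⟩ := exists_matching_card_eq G
  obtain ⟨C, hC, e2⟩ := exists_cover_card_eq G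
  have hcard : M.card = C.card := by rw [e1, e2]; exact hG
  have h : ∀ e : Sym2 (Fin n), ∃ v : Fin n, e ∈ M → v ∈ C ∧ v ∈ e := by
    intro e
    by_cases he : e ∈ M
    · obtain ⟨v, h1, h2⟩ := hC e (hM.1 e he)
      exact ⟨v, fun _ => ⟨h1, h2⟩⟩
    · induction e with
      | _ x y => exact ⟨x, fun h => absurd h he⟩
  choose g hg using h
  have hinj : Set.InjOn g M := by
    intro e he f hf hef
    by_contra hne
    exact hM.2 e he f hf hne (g e) (hg e he).2 (hef ▸ (hg f hf).2)
  have hsurj : ∀ c ∈ C, ∃ e ∈ M, g e = c := by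
    have : M.image g = C := by
      apply Finset.eq_of_subset_of_card_le
      · intro c hc
        obtain ⟨e, he, rfl⟩ := Finset.mem_image.1 hc
        exact (hg e he).1
      · rw [Finset.card_image_of_injOn hinj, hcard]
    intro c hc
    rw [← this] at hc
    simpa using hc
  have hpart : ∀ c : Fin n, ∃ d : Fin n, c ∈ C → s(c, d) ∈ M ∧ g s(c, d) = c := by
    intro c
    by_cases hc : c ∈ C
    · obtain ⟨e, he, hge⟩ := hsurj c hc
      obtain ⟨d, rfl⟩ : ∃ d, e = s(c, d) := by
        have := (hg e he).2
        rw [hge] at this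
        exact this
      exact ⟨d, fun _ => ⟨he, hge⟩⟩
    · exact ⟨c, fun h => absurd h hc⟩
  choose f hf using hpart
  refine ⟨C, hC, f, ?_, ?_⟩
  · intro c hc d hd hcd
    have : s(c, f c) = s(d, f d) := by
      by_contra hne
      exact hM.2 _ (hf c hc).1 _ (hf d hd).1 hne (f c) (Sym2.mem_mk_right _ _)
        (hcd ▸ Sym2.mem_mk_right _ _)
    rw [← (hf c hc).2, this, (hf d hd).2]
  · intro c hc
    have hadj : G.Adj c (f c) := hM.1 _ (hf c hc).1
    refine ⟨Finset.mem_compl.2 fun hfc => ?_, hadj⟩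
    have : s(c, f c) = s(f c, f (f c)) := by
      by_contra hne
      exact hM.2 _ (hf c hc).1 _ (hf _ hfc).1 hne (f c) (Sym2.mem_mk_right _ _)
        (Sym2.mem_mk_left _ _)
    have h2 := (hf _ hfc).2
    rw [← this, (hf c hc).2] at h2
    exact hadj.ne h2

theorem MatchesInto.isMatchingOn {n : ℕ} {G : SimpleGraph (Fin n)} {C J : Finset (Fin n)}
    {f : Fin n → Fin n} (h : MatchesInto G C J f) (hJ : Disjoint C J) :
    IsMatchingOn G (C.image fun c => s(c, f c)) ∧ (C.image fun c => s(c, f c)).card = C.card := by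
  have key : ∀ c ∈ C, ∀ d ∈ C, ∀ v, v ∈ s(c, f c) → v ∈ s(d, f d) → c = d := by
    intro c hc d hd v hv hv'
    have h1 := Finset.disjoint_left.1 hJ
    rw [Sym2.mem_iff] at hv hv'
    rcases hv with rfl | rfl <;> rcases hv' with h2 | h2
    · exact h2
    · exact absurd (h.2 d hd).1 (h2 ▸ h1 hc)
    · exact absurd (h.2 c hc).1 (h2 ▸ h1 hd)
    · exact h.1 hc hd h2
  refine ⟨⟨?_, ?_⟩, ?_⟩
  · intro e he
    obtain ⟨c, hc, rfl⟩ := Finset.mem_image.1 he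
    exact (h.2 c hc).2
  · intro e he e' he' hne v hv hv'
    obtain ⟨c, hc, rfl⟩ := Finset.mem_image.1 he
    obtain ⟨d, hd, rfl⟩ := Finset.mem_image.1 he'
    exact hne (by rw [key c hc d hd v hv hv'])
  · refine Finset.card_image_of_injOn fun c hc d hd hcd => ?_
    have hcd' : s(c, f c) = s(d, f d) := hcd
    exact key c hc d hd c (Sym2.mem_mk_left _ _) (hcd' ▸ Sym2.mem_mk_left _ _)

theorem IsMatchedCover.card_eq {n : ℕ} {G : SimpleGraph (Fin n)} {C : Finset (Fin n)}
    (hC : IsMatchedCover G C) : C.card = matchNum G := by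
  obtain ⟨h1, f, hf⟩ := hC
  obtain ⟨h2, h3⟩ := hf.isMatchingOn disjoint_compl_right
  obtain ⟨M, hM, e⟩ := exists_matching_card_eq G
  have h4 := h2.card_le_matchNum
  have h5 := hM.card_le_cover h1
  omega

/-- The graph obtained from `G` by adding the edge `e`. -/
abbrev addEdge {n : ℕ} (G : SimpleGraph (Fin n)) (e : Sym2 (Fin n)) : SimpleGraph (Fin n) :=
  G ⊔ SimpleGraph.fromEdgeSet {e}

theorem IsMatchingOn.mono {n : ℕ} {G H : SimpleGraph (Fin n)} {M : Finset (Sym2 (Fin n))}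
    (hM : IsMatchingOn G M) (h : G ≤ H) : IsMatchingOn H M :=
  ⟨fun e he => SimpleGraph.edgeSet_mono h (hM.1 e he), hM.2⟩

theorem matchNum_mono {n : ℕ} {G H : SimpleGraph (Fin n)} (h : G ≤ H) :
    matchNum G ≤ matchNum H := by
  obtain ⟨M, hM, e⟩ := exists_matching_card_eq G
  exact e ▸ (hM.mono h).card_le_matchNum

theorem IsVertexCover.addEdge {n : ℕ} {G : SimpleGraph (Fin n)} {C : Finset (Fin n)}
    (hC : IsVertexCover G C) {e : Sym2 (Fin n)} {v : Fin n} (hv : v ∈ C) (hve : v ∈ e) :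
    IsVertexCover (addEdge G e) C := by
  intro e' he'
  rw [SimpleGraph.edgeSet_sup, SimpleGraph.edgeSet_fromEdgeSet] at he'
  rcases he' with h | h
  · exact hC e' h
  · have : e' = e := h.1
    exact ⟨v, hv, this ▸ hve⟩

/-- Adding an edge that meets a minimum vertex cover keeps a graph König. -/
theorem IsMatchedCover.isKonig_addEdge {n : ℕ} {G : SimpleGraph (Fin n)} {C : Finset (Fin n)}
    (hC : IsMatchedCover G C) {e : Sym2 (Fin n)} {v : Fin n} (hv : v ∈ C) (hve : v ∈ e) :
    IsKonig (addEdge G e) := by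
  obtain ⟨h1, f, hf⟩ := hC
  obtain ⟨h2, h3⟩ := hf.isMatchingOn disjoint_compl_right
  exact isKonig_of_card_le (h2.mono le_sup_left) (h1.addEdge hv hve) h3.ge

/-- The edges whose addition to `G` gives a König graph with a larger matching number. -/
def improving {n : ℕ} (G : SimpleGraph (Fin n)) : Finset (Sym2 (Fin n)) :=
  Finset.univ.filter fun e =>
    ¬ e.IsDiag ∧ IsKonig (addEdge G e) ∧ matchNum G < matchNum (addEdge G e)

/-- A pair of vertices that is missed by a maximum matching is an improving edge. -/
theorem mem_improving {n : ℕ} {G : SimpleGraph (Fin n)} {C J : Finset (Fin n)}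
    (hC : IsMatchedCover G C) {f : Fin n → Fin n} (hf : MatchesInto G C J f) (hJ : J ⊆ Cᶜ)
    {x y : Fin n} (hxy : x ≠ y) (hx : x ∉ C) (hy : y ∉ C) (hx' : ∀ c ∈ C, f c ≠ x)
    (hy' : ∀ c ∈ C, f c ≠ y) : s(x, y) ∈ improving G := by
  obtain ⟨h2, h3⟩ := hf.isMatchingOn
    (Finset.disjoint_left.2 fun c hc hcJ => Finset.mem_compl.1 (hJ hcJ) hc)
  set M := C.image fun c => s(c, f c) with hMdef
  have hfree : ∀ e ∈ M, x ∉ e ∧ y ∉ e := by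
    intro e he
    obtain ⟨c, hc, rfl⟩ := Finset.mem_image.1 he
    simp only [Sym2.mem_iff, not_or]
    exact ⟨⟨fun h => hx (h ▸ hc), (hx' c hc).symm⟩, fun h => hy (h ▸ hc), (hy' c hc).symm⟩
  have hnot : s(x, y) ∉ M := fun h => (hfree _ h).1 (Sym2.mem_mk_left _ _)
  have hM : IsMatchingOn (addEdge G s(x, y)) (insert s(x, y) M) := by
    have hdis : ∀ e ∈ M, ∀ v, v ∈ e → v ∉ s(x, y) := by
      intro e he v hv hv'
      rcases Sym2.mem_iff.1 hv' with rfl | rfl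
      · exact (hfree e he).1 hv
      · exact (hfree e he).2 hv
    refine ⟨?_, ?_⟩
    · intro e he
      rw [SimpleGraph.edgeSet_sup, SimpleGraph.edgeSet_fromEdgeSet]
      rcases Finset.mem_insert.1 he with rfl | h
      · exact Or.inr ⟨rfl, by simpa using hxy⟩
      · exact Or.inl (h2.1 e h)
    · intro e he e' he' hne v hv hv'
      rcases Finset.mem_insert.1 he with rfl | h <;> rcases Finset.mem_insert.1 he' with rfl | h'
      · exact hne rfl
      · exact hdis _ h' v hv' hv
      · exact hdis _ h v hv hv'
      · exact h2.2 e h e' h' hne v hv hv'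
  have hMcard : (insert s(x, y) M).card = C.card + 1 := by
    rw [Finset.card_insert_of_notMem hnot, h3]
  have hcov : IsVertexCover (addEdge G s(x, y)) (insert x C) := by
    refine IsVertexCover.addEdge (v := x) ?_ (Finset.mem_insert_self x C) (Sym2.mem_mk_left _ _)
    intro e he
    obtain ⟨v, hv, hve⟩ := hC.1 e he
    exact ⟨v, Finset.mem_insert_of_mem hv, hve⟩
  refine Finset.mem_filter.2 ⟨Finset.mem_univ _, by simpa using hxy,
    isKonig_of_card_le hM hcov ?_, ?_⟩
  · rw [hMcard]; exact Finset.card_insert_le _ _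
  · have := hM.card_le_matchNum
    rw [← hC.card_eq]
    omega

theorem card_le_two_mul_card_improving {n : ℕ} {G : SimpleGraph (Fin n)}
    {P : Finset (Fin n × Fin n)} (hP : ∀ q ∈ P, s(q.1, q.2) ∈ improving G) :
    P.card ≤ 2 * (improving G).card := by
  refine (Finset.card_le_mul_card_image_of_maps_to (f := fun q => s(q.1, q.2)) hP 2 ?_)
  intro e _
  induction e with
  | _ x y =>
    refine (Finset.card_le_card (t := {(x, y), (y, x)}) ?_).trans Finset.card_le_two
    intro q hq
    have := (Finset.mem_filter.1 hq).2
    rw [Sym2.eq_iff] at this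
    simpa [Prod.ext_iff] using this

/-- If the matching number is small, then many edges are improving. -/
theorem IsKonig.unmatched_le_improving {n : ℕ} {G : SimpleGraph (Fin n)} (hG : IsKonig G) :
    (n - 2 * matchNum G) * (n - 2 * matchNum G) - (n - 2 * matchNum G) ≤
      2 * (improving G).card := by
  obtain ⟨C, hC⟩ := hG.exists_isMatchedCover
  obtain ⟨f, hf⟩ := hC.2
  set U : Finset (Fin n) := (C ∪ C.image f)ᶜ with hU
  have hUcard : n - 2 * matchNum G ≤ U.card := by
    have h1 := Finset.card_union_le C (C.image f)
    have h2 : (C.image f).card ≤ C.card := Finset.card_image_le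
    rw [hU, Finset.card_compl, Fintype.card_fin, ← hC.card_eq]
    omega
  have hoff := card_le_two_mul_card_improving (G := G) (P := U.offDiag) ?_
  · rw [Finset.offDiag_card] at hoff
    refine le_trans ?_ hoff
    rw [← Nat.mul_sub_one, ← Nat.mul_sub_one]
    gcongr
  · rintro ⟨x, y⟩ hq
    simp only [Finset.mem_offDiag, hU, Finset.mem_compl, Finset.mem_union, not_or,
      Finset.mem_image, not_exists, not_and] at hq
    exact mem_improving hC hf subset_rfl hq.2.2 hq.1.1 hq.2.1.1 hq.1.2 hq.2.1.2

theorem exists_matchesInto_of_hall {n : ℕ} {G : SimpleGraph (Fin n)} {C J : Finset (Fin n)}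
    (h : ∀ T ⊆ C, T.card ≤ (T.biUnion fun c => J.filter (G.Adj c)).card) :
    ∃ f, MatchesInto G C J f := by
  have h' : ∀ s : Finset C, s.card ≤ (s.biUnion fun c => J.filter (G.Adj c.1)).card := by
    intro s
    have := h (s.map (Function.Embedding.subtype _)) (by
      intro c hc
      obtain ⟨d, _, rfl⟩ := Finset.mem_map.1 hc
      exact d.2)
    rw [Finset.card_map] at this
    refine this.trans (Finset.card_le_card ?_)
    intro y hy
    simp only [Finset.mem_biUnion, Finset.mem_map, Finset.mem_filter] at hy ⊢
    obtain ⟨c, ⟨d, hd, rfl⟩, h2⟩ := hy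
    exact ⟨d, hd, h2⟩
  obtain ⟨g, hg1, hg2⟩ := (Finset.all_card_le_biUnion_card_iff_exists_injective _).1 h'
  refine ⟨fun v => if hv : v ∈ C then g ⟨v, hv⟩ else v, ?_, ?_⟩
  · intro c hc d hd hcd
    have hc' : c ∈ C := hc
    have hd' : d ∈ C := hd
    simp only [hc', hd', dif_pos] at hcd
    simpa using hg1 hcd
  · intro c hc
    simp only [hc, dif_pos]
    simpa using hg2 ⟨c, hc⟩

theorem MatchesInto.hall {n : ℕ} {G : SimpleGraph (Fin n)} {C J : Finset (Fin n)}
    {f : Fin n → Fin n} (hf : MatchesInto G C J f) {T : Finset (Fin n)} (hT : T ⊆ C) :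
    T.card ≤ (T.biUnion fun c => J.filter (G.Adj c)).card := by
  refine Finset.card_le_card_of_injOn f ?_ (hf.1.mono (Finset.coe_subset.2 hT))
  intro c hc
  have := hf.2 c (hT hc)
  simp only [Finset.coe_biUnion, Set.mem_iUnion]
  exact ⟨c, hc, by simpa using this⟩

/-- If small subsets of `J` expand into `C`, then `C` can be matched into `J` so that a prescribed
vertex is missed, for many choices of that vertex. -/
theorem MatchesInto.lt_card_avoidable {n : ℕ} {G : SimpleGraph (Fin n)} {C J : Finset (Fin n)}
    {f : Fin n → Fin n} (hf : MatchesInto G C J f) (hCJ : C.card < J.card) {s₀ : ℕ}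
    (hexp : ∀ S ⊆ J, S.Nonempty → S.card ≤ s₀ →
      S.card ≤ (C.filter fun c => ∃ x ∈ S, G.Adj c x).card) :
    s₀ < (J.filter fun x => ∃ g, MatchesInto G C (J.erase x) g).card := by
  set NJ : Finset (Fin n) → Finset (Fin n) := fun T => T.biUnion fun c => J.filter (G.Adj c)
    with hNJ
  have memNJ : ∀ T y, y ∈ NJ T ↔ y ∈ J ∧ ∃ c ∈ T, G.Adj c y := by
    intro T y
    simp only [hNJ, Finset.mem_biUnion, Finset.mem_filter]
    tauto
  obtain ⟨T₀, hT₀, hmax⟩ := Finset.exists_max_image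
    (C.powerset.filter fun T => (NJ T).card ≤ T.card) Finset.card
    ⟨∅, by simp [hNJ]⟩
  simp only [Finset.mem_filter, Finset.mem_powerset] at hT₀ hmax
  set S := J \ NJ T₀ with hS
  have hNsub : NJ T₀ ⊆ J := fun y hy => ((memNJ _ _).1 hy).1
  have hScard : S.card = J.card - (NJ T₀).card := Finset.card_sdiff_of_subset hNsub
  have hNS : (C.filter fun c => ∃ x ∈ S, G.Adj c x).card ≤ C.card - T₀.card := by
    rw [← Finset.card_sdiff_of_subset hT₀.1]
    refine Finset.card_le_card fun c hc => ?_
    obtain ⟨hcC, x, hxS, hadj⟩ := Finset.mem_filter.1 hc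
    refine Finset.mem_sdiff.2 ⟨hcC, fun hcT => ?_⟩
    have := Finset.mem_sdiff.1 hxS
    exact this.2 ((memNJ _ _).2 ⟨this.1, c, hcT, hadj⟩)
  have hTC := Finset.card_le_card hT₀.1
  have hSpos : C.card - T₀.card < S.card := by omega
  have hS₀ : s₀ < S.card := by
    by_contra hle
    have := hexp S Finset.sdiff_subset (Finset.card_pos.1 (by omega)) (by omega)
    omega
  refine hS₀.trans_le (Finset.card_le_card fun x hx => ?_)
  have hxS := Finset.mem_sdiff.1 hx
  refine Finset.mem_filter.2 ⟨hxS.1, exists_matchesInto_of_hall ?_⟩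
  intro T hT
  by_contra hlt
  push Not at hlt
  have hsub : NJ T ⊆ insert x (T.biUnion fun c => (J.erase x).filter (G.Adj c)) := by
    intro y hy
    obtain ⟨hyJ, c, hcT, hadj⟩ := (memNJ _ _).1 hy
    by_cases hyx : y = x
    · simp [hyx]
    · refine Finset.mem_insert_of_mem (Finset.mem_biUnion.2 ⟨c, hcT, ?_⟩)
      simp [hyx, hyJ, hadj]
  have htight : (NJ T).card ≤ T.card := by
    have := (Finset.card_le_card hsub).trans (Finset.card_insert_le _ _)
    omega
  have hxT : x ∈ NJ T := by
    by_contra hxT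
    have : NJ T ⊆ T.biUnion fun c => (J.erase x).filter (G.Adj c) := by
      intro y hy
      rcases Finset.mem_insert.1 (hsub hy) with rfl | h
      · exact absurd hy hxT
      · exact h
    have h1 := Finset.card_le_card this
    have h2 := hf.hall hT
    have h3 : (T.biUnion fun c => J.filter (G.Adj c)) = NJ T := rfl
    rw [h3] at h2
    omega
  have hunion : (NJ (T ∪ T₀)).card ≤ (T ∪ T₀).card := by
    have e1 : NJ (T ∪ T₀) = NJ T ∪ NJ T₀ := Finset.union_biUnion
    have e2 : NJ (T ∩ T₀) ⊆ NJ T ∩ NJ T₀ :=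
      Finset.subset_inter (Finset.biUnion_subset_biUnion_of_subset_left _ Finset.inter_subset_left)
        (Finset.biUnion_subset_biUnion_of_subset_left _ Finset.inter_subset_right)
    have h1 := Finset.card_union_add_card_inter (NJ T) (NJ T₀)
    have h2 := Finset.card_union_add_card_inter T T₀
    have h3 := Finset.card_le_card e2
    have h4 : (T ∩ T₀).card ≤ (NJ (T ∩ T₀)).card :=
      hf.hall (Finset.inter_subset_left.trans hT)
    rw [e1]
    omega
  have hle := hmax (T ∪ T₀) ⟨Finset.union_subset hT hT₀.1, hunion⟩
  have heq : T₀ = T ∪ T₀ := Finset.eq_of_subset_of_card_le Finset.subset_union_right hle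
  have hTT₀ : T ⊆ T₀ := by rw [heq]; exact Finset.subset_union_left
  obtain ⟨hyJ, c, hcT, hadj⟩ := (memNJ _ _).1 hxT
  exact hxS.2 ((memNJ _ _).2 ⟨hyJ, c, hTT₀ hcT, hadj⟩)

/-- If small independent sets expand and there is no perfect matching, then many edges are
improving. -/
theorem IsKonig.sq_le_improving {n : ℕ} {G : SimpleGraph (Fin n)} (hG : IsKonig G)
    (hn : 2 * matchNum G + 2 ≤ n) {s₀ : ℕ}
    (hexp : ∀ S W : Finset (Fin n), S.Nonempty → S.card ≤ s₀ → Disjoint S W →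
      (∀ x ∈ S, ∀ y, G.Adj x y → y ∈ W) → S.card ≤ W.card) :
    s₀ * s₀ ≤ 2 * (improving G).card := by
  obtain ⟨C, hC⟩ := hG.exists_isMatchedCover
  obtain ⟨f, hf⟩ := hC.2
  have hCcard := hC.card_eq
  have hIcard : (Cᶜ).card = n - C.card := by rw [Finset.card_compl, Fintype.card_fin]
  have hexp' : ∀ J ⊆ Cᶜ, ∀ S ⊆ J, S.Nonempty → S.card ≤ s₀ →
      S.card ≤ (C.filter fun c => ∃ x ∈ S, G.Adj c x).card := by
    intro J hJ S hS hne hcard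
    refine hexp S _ hne hcard ?_ ?_
    · rw [Finset.disjoint_left]
      intro x hx hx'
      exact Finset.mem_compl.1 (hJ (hS hx)) (Finset.mem_filter.1 hx').1
    · intro x hx y hxy
      obtain ⟨v, hv, hve⟩ := hC.1 s(x, y) hxy
      rcases Sym2.mem_iff.1 hve with rfl | rfl
      · exact absurd hv (Finset.mem_compl.1 (hJ (hS hx)))
      · exact Finset.mem_filter.2 ⟨hv, x, hx, hxy.symm⟩
  have h1 := hf.lt_card_avoidable (by omega) (hexp' _ subset_rfl)
  set X := (Cᶜ).filter fun x => ∃ g, MatchesInto G C (Cᶜ.erase x) g with hX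
  set Y : Fin n → Finset (Fin n) := fun x =>
    (Cᶜ.erase x).filter fun y => ∃ g, MatchesInto G C ((Cᶜ.erase x).erase y) g with hY
  have hYcard : ∀ x ∈ X, s₀ ≤ (Y x).card := by
    intro x hx
    obtain ⟨hxC, g, hg⟩ := Finset.mem_filter.1 hx
    refine (hg.lt_card_avoidable ?_ (hexp' _ (Finset.erase_subset _ _))).le
    rw [Finset.card_erase_of_mem hxC]
    omega
  have hP := card_le_two_mul_card_improving (G := G)
    (P := (X.sigma Y).map (Equiv.sigmaEquivProd (Fin n) (Fin n)).toEmbedding) ?_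
  · rw [Finset.card_map, Finset.card_sigma] at hP
    refine le_trans ?_ hP
    calc s₀ * s₀ ≤ X.card * s₀ := Nat.mul_le_mul_right _ h1.le
      _ = ∑ x ∈ X, s₀ := by rw [Finset.sum_const, smul_eq_mul]
      _ ≤ _ := Finset.sum_le_sum hYcard
  · intro q hq
    obtain ⟨⟨x, y⟩, hxy, rfl⟩ := Finset.mem_map.1 hq
    obtain ⟨hx, hy⟩ := Finset.mem_sigma.1 hxy
    obtain ⟨hyC, g, hg⟩ := Finset.mem_filter.1 hy
    have hyx := (Finset.mem_erase.1 hyC).1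
    have hsub : (Cᶜ.erase x).erase y ⊆ Cᶜ :=
      (Finset.erase_subset _ _).trans (Finset.erase_subset _ _)
    refine mem_improving hC hg hsub hyx.symm
      (Finset.mem_compl.1 (Finset.mem_filter.1 hx).1)
      (Finset.mem_compl.1 (Finset.mem_erase.1 hyC).2) ?_ ?_
    · intro c hc h
      have := (hg.2 c hc).1
      simp [h] at this
    · intro c hc h
      have := (hg.2 c hc).1
      simp [h] at this

/-! ### The König process -/

theorem konigProc_succ_of_isKonig {n : ℕ} (σ : EdgeOrdering n) {t : ℕ} (h : t < n*(n-1)/2)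
    (hk : IsKonig (addEdge (KonigProc σ t) (σ.1 ⟨t, h⟩))) :
    KonigProc σ (t + 1) = addEdge (KonigProc σ t) (σ.1 ⟨t, h⟩) := by
  rw [KonigProc, dif_pos h, if_pos hk]

theorem konigProc_le_succ {n : ℕ} (σ : EdgeOrdering n) (t : ℕ) :
    KonigProc σ t ≤ KonigProc σ (t + 1) := by
  rw [KonigProc]
  split_ifs
  · exact le_sup_left
  · exact le_rfl
  · exact le_rfl

theorem konigProc_mono {n : ℕ} (σ : EdgeOrdering n) : Monotone (KonigProc σ) :=
  monotone_nat_of_le_succ (konigProc_le_succ σ)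

theorem isKonig_konigProc {n : ℕ} (σ : EdgeOrdering n) (t : ℕ) : IsKonig (KonigProc σ t) := by
  induction t with
  | zero =>
    refine isKonig_of_card_le (M := ∅) (C := ∅) (by simp [IsMatchingOn]) ?_ le_rfl
    intro e he
    simp [KonigProc] at he
  | succ t ih =>
    rw [KonigProc]
    split_ifs with h1 h2
    · exact h2
    · exact ih
    · exact ih

theorem konigProc_congr {n : ℕ} {t : ℕ} {σ τ : EdgeOrdering n} (h : EdgeOrdering.Agree t σ τ) :
    KonigProc σ t = KonigProc τ t := by
  induction t with
  | zero => rfl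
  | succ t ih =>
    rw [KonigProc, KonigProc, ih (h.mono (Nat.le_succ t))]
    by_cases ht : t < n*(n-1)/2
    · simp only [dif_pos ht, h ⟨t, ht⟩ (Nat.lt_succ_self t)]
    · simp only [dif_neg ht]

theorem exists_eq_of_mem_konigProc {n : ℕ} (σ : EdgeOrdering n) {t : ℕ} {e : Sym2 (Fin n)}
    (he : e ∈ (KonigProc σ t).edgeSet) : ∃ i : Fin (n*(n-1)/2), i.1 < t ∧ σ.1 i = e := by
  induction t with
  | zero => simp [KonigProc] at he
  | succ t ih =>
    have key : e ∈ (KonigProc σ t).edgeSet → ∃ i : Fin (n*(n-1)/2), i.1 < t + 1 ∧ σ.1 i = e :=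
      fun h => (ih h).imp fun i hi => ⟨hi.1.trans (Nat.lt_succ_self t), hi.2⟩
    rw [KonigProc] at he
    split_ifs at he with h1 h2
    · rw [SimpleGraph.edgeSet_sup, SimpleGraph.edgeSet_fromEdgeSet] at he
      rcases he with h | h
      · exact key h
      · have : e = σ.1 ⟨t, h1⟩ := h.1
        exact ⟨⟨t, h1⟩, Nat.lt_succ_self t, this.symm⟩
    · exact key he
    · exact key he

theorem matchNum_add_hits_le {n : ℕ} {A : ℕ → EdgeOrdering n → Finset (Sym2 (Fin n))}
    {σ : EdgeOrdering n} {a b : ℕ} (hab : a ≤ b)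
    (hA : ∀ t, a ≤ t → t < b → A t σ = improving (KonigProc σ t)) :
    matchNum (KonigProc σ a) + hits A a b σ ≤ matchNum (KonigProc σ b) := by
  induction b, hab using Nat.le_induction with
  | base => simp [hits]
  | succ b hab ih =>
    have ih' := ih fun t h1 h2 => hA t h1 (h2.trans (Nat.lt_succ_self b))
    rw [hits_succ A hab]
    have hm := matchNum_mono (konigProc_le_succ σ b)
    split_ifs with h
    · rw [hA b hab (Nat.lt_succ_self b)] at h
      obtain ⟨hb, h⟩ := h
      obtain ⟨_, _, h1, h2⟩ := Finset.mem_filter.1 h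
      rw [konigProc_succ_of_isKonig σ hb h1]
      omega
    · omega

/-- All edges of the complete graph. -/
def allEdges (n : ℕ) : Finset (Sym2 (Fin n)) := Finset.univ.filter fun e => ¬ e.IsDiag

theorem sub_le_card_remaining_allEdges {n : ℕ} (σ : EdgeOrdering n) (t : ℕ) :
    ((n*(n-1)/2 : ℕ) - t : ℝ) ≤ (remaining σ t (allEdges n)).card := by
  have h1 := card_le_remaining_add σ t (S := allEdges n) fun e he => (Finset.mem_filter.1 he).2
  have h2 := hits_le (fun _ _ => allEdges n) 0 t σ
  have h3 : (allEdges n).card = n*(n-1)/2 := card_nondiag n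
  rw [h3] at h1
  have h4 : n*(n-1)/2 ≤ (remaining σ t (allEdges n)).card + t := by omega
  have h5 : ((n*(n-1)/2 : ℕ) : ℝ) ≤ (remaining σ t (allEdges n)).card + t := by exact_mod_cast h4
  linarith

theorem cast_numEdges (n : ℕ) : ((n*(n-1)/2 : ℕ) : ℝ) = n * (n - 1) / 2 := by
  rw [← Nat.choose_two_right, Nat.cast_choose_two]

/-- It is unlikely that many edges are improving during a long period of time. -/
theorem Pr_many_improving_le {n : ℕ} {q : ℝ} (hq0 : 0 ≤ q) (hq1 : q ≤ 1) {a b : ℕ} (hab : a ≤ b)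
    (hb : b ≤ n*(n-1)/2) (hbq : (b : ℝ) ≤ q * n ^ 2 / 2) :
    Pr n (fun σ => ∀ t, a ≤ t → t < b → q * n ^ 2 ≤ (improving (KonigProc σ t)).card) ≤
      Real.exp (n / 2 - q / 2 * (b - a)) := by
  set A : ℕ → EdgeOrdering n → Finset (Sym2 (Fin n)) := fun t σ =>
    if q * n ^ 2 ≤ (improving (KonigProc σ t)).card then improving (KonigProc σ t)
    else allEdges n with hAdef
  have hA : ∀ t σ τ, EdgeOrdering.Agree t σ τ → A t σ = A t τ := by
    intro t σ τ h
    simp only [hAdef, konigProc_congr h]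
  have hexp : Real.exp (-1) - 1 ≤ -(1/2) := by
    have := Real.exp_neg_one_lt_d9
    linarith
  have hbase := Pr_hits_le (-1) q (n / 2) hA hab hb ?_
  · refine (Pr_mono ?_).trans (hbase.trans (Real.exp_le_exp.2 ?_))
    · intro σ hσ
      have h1 := matchNum_add_hits_le (A := A) hab (σ := σ) fun t h1 h2 => by
        simp only [hAdef]
        rw [if_pos (hσ t h1 h2)]
      have h2 := two_mul_matchNum_le (KonigProc σ b)
      have h3 : 2 * hits A a b σ ≤ n := by omega
      have h4 : (2:ℝ) * hits A a b σ ≤ n := by exact_mod_cast h3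
      linarith
    · have h1 : (0:ℝ) ≤ q * ((b:ℝ) - a) :=
        mul_nonneg hq0 (sub_nonneg.2 (by exact_mod_cast hab))
      nlinarith
  · intro t σ hat htb
    refine mul_le_mul_of_nonpos_left ?_ (by linarith)
    have htN : (t : ℝ) ≤ ((n*(n-1)/2 : ℕ) : ℝ) := by exact_mod_cast (htb.trans_le hb).le
    have htb' : (t : ℝ) ≤ b := by exact_mod_cast htb.le
    simp only [hAdef]
    split_ifs with h
    · have h1 := card_le_remaining_add σ t (S := improving (KonigProc σ t))
        fun e he => (Finset.mem_filter.1 he).2.1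
      have h2 := hits_le (fun _ _ => improving (KonigProc σ t)) 0 t σ
      have h3 : (improving (KonigProc σ t)).card ≤
        (remaining σ t (improving (KonigProc σ t))).card + t := by omega
      have h4 : ((improving (KonigProc σ t)).card : ℝ) ≤
        (remaining σ t (improving (KonigProc σ t))).card + t := by exact_mod_cast h3
      rw [cast_numEdges]
      have hn : (0:ℝ) ≤ n := Nat.cast_nonneg n
      have ht : (0:ℝ) ≤ t := Nat.cast_nonneg t
      have h5 : 0 ≤ q * n := mul_nonneg hq0 hn
      have h6 : 0 ≤ q * t := mul_nonneg hq0 ht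
      nlinarith
    · have := sub_le_card_remaining_allEdges σ t
      nlinarith

/-- Upper tail of the number of edges of a fixed set among the first `m` edges. -/
theorem Pr_static_hits_le {n : ℕ} {lam : ℝ} (hlam : 0 ≤ lam) (q : ℝ) (S : Finset (Sym2 (Fin n)))
    {m : ℕ} (hn : 0 < n) (hm : (n : ℝ) ^ 2 / 8 ≤ (n*(n-1)/2 : ℕ) - m) {c : ℝ}
    (hS : (S.card : ℝ) ≤ c) :
    Pr n (fun σ => lam * q ≤ lam * hits (fun _ _ => S) 0 m σ) ≤
      Real.exp (-(lam * q) + Real.exp lam * (8 * c / n ^ 2) * m) := by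
  have hnpos : (0:ℝ) < n := by exact_mod_cast hn
  have hc : 0 ≤ c := le_trans (Nat.cast_nonneg _) hS
  have hmN : m ≤ n*(n-1)/2 := by
    have : (m:ℝ) ≤ (n*(n-1)/2 : ℕ) := by nlinarith [sq_nonneg (n:ℝ)]
    exact_mod_cast this
  have h1 : 0 ≤ Real.exp lam - 1 := by
    have := Real.one_le_exp hlam
    linarith
  refine (Pr_hits_le lam (8 * c / n ^ 2) q (fun _ _ _ _ => rfl) (Nat.zero_le m) hmN ?_).trans ?_
  · intro t σ _ ht
    refine mul_le_mul_of_nonneg_left ?_ h1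
    have h2 : ((remaining σ t S).card : ℝ) ≤ S.card := by
      exact_mod_cast card_remaining_le σ t S
    have ht' : (t:ℝ) ≤ m := by exact_mod_cast ht.le
    refine (h2.trans hS).trans ?_
    calc c = 8 * c / n ^ 2 * (n ^ 2 / 8) := by field_simp
      _ ≤ _ := by
        refine mul_le_mul_of_nonneg_left ?_ (by positivity)
        linarith
  · refine Real.exp_le_exp.2 ?_
    have : 0 ≤ 8 * c / n ^ 2 * m := by positivity
    simp only [Nat.cast_zero, sub_zero]
    nlinarith

/-- The edges joining `v` to the other vertices of `W`. -/
def starEdges {n : ℕ} (v : Fin n) (W : Finset (Fin n)) : Finset (Sym2 (Fin n)) :=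
  (W.erase v).image fun w => s(v, w)

theorem card_starEdges {n : ℕ} (v : Fin n) (W : Finset (Fin n)) :
    (starEdges v W).card = (W.erase v).card :=
  Finset.card_image_of_injective _ fun _ _ h => Sym2.congr_right.1 h

theorem not_isDiag_of_mem_starEdges {n : ℕ} {v : Fin n} {W : Finset (Fin n)} {e : Sym2 (Fin n)}
    (he : e ∈ starEdges v W) : ¬ e.IsDiag := by
  obtain ⟨w, hw, rfl⟩ := Finset.mem_image.1 he
  simpa using (Finset.mem_erase.1 hw).1.symm

theorem starEdges_mono {n : ℕ} (v : Fin n) {W W' : Finset (Fin n)} (h : W ⊆ W') :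
    starEdges v W ⊆ starEdges v W' :=
  Finset.image_subset_image (Finset.erase_subset_erase v h)

/-- A minimum vertex cover of a König graph. -/
def coverOf {n : ℕ} (G : SimpleGraph (Fin n)) : Finset (Fin n) :=
  Classical.epsilon fun C => IsMatchedCover G C

theorem IsKonig.isMatchedCover_coverOf {n : ℕ} {G : SimpleGraph (Fin n)} (hG : IsKonig G) :
    IsMatchedCover G (coverOf G) :=
  Classical.epsilon_spec hG.exists_isMatchedCover

/-- The number of neighbours of `v` in `G`. -/
def degreeOf {n : ℕ} (G : SimpleGraph (Fin n)) (v : Fin n) : ℕ :=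
  (Finset.univ.filter fun w => G.Adj v w).card

theorem hits_star_le_degreeOf {n : ℕ} {A : ℕ → EdgeOrdering n → Finset (Sym2 (Fin n))}
    {σ : EdgeOrdering n} {a b : ℕ} {v : Fin n}
    (hA : ∀ t, a ≤ t → t < b → A t σ = starEdges v (coverOf (KonigProc σ t))) :
    hits A a b σ ≤ degreeOf (KonigProc σ b) v := by
  have hstep : ∀ t ∈ (Finset.Ico a b).filter (fun t => σ.Hit t (A t σ)),
      ∃ w, (KonigProc σ b).Adj v w ∧ ∃ h : t < n*(n-1)/2, σ.1 ⟨t, h⟩ = s(v, w) := by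
    intro t ht
    obtain ⟨h1, h2, h3⟩ := Finset.mem_filter.1 ht
    obtain ⟨h4, h5⟩ := Finset.mem_Ico.1 h1
    rw [hA t h4 h5] at h3
    obtain ⟨w, hw, hwe⟩ := Finset.mem_image.1 h3
    refine ⟨w, ?_, h2, hwe.symm⟩
    have hk := (isKonig_konigProc σ t).isMatchedCover_coverOf.isKonig_addEdge
      (e := σ.1 ⟨t, h2⟩) (Finset.mem_of_mem_erase hw) (by rw [← hwe]; exact Sym2.mem_mk_right _ _)
    have hle := konigProc_mono σ (show t + 1 ≤ b from h5)
    rw [konigProc_succ_of_isKonig σ h2 hk] at hle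
    refine hle (Or.inr ?_)
    rw [SimpleGraph.fromEdgeSet_adj]
    exact ⟨hwe, (Finset.mem_erase.1 hw).1.symm⟩
  have hch : ∀ t : ℕ, ∃ w : Fin n, t ∈ (Finset.Ico a b).filter (fun t => σ.Hit t (A t σ)) →
      (KonigProc σ b).Adj v w ∧ ∃ h : t < n*(n-1)/2, σ.1 ⟨t, h⟩ = s(v, w) := by
    intro t
    by_cases ht : t ∈ (Finset.Ico a b).filter (fun t => σ.Hit t (A t σ))
    · obtain ⟨w, hw⟩ := hstep t ht
      exact ⟨w, fun _ => hw⟩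
    · exact ⟨v, fun h => absurd h ht⟩
  choose g hg using hch
  refine Finset.card_le_card_of_injOn g (fun t ht => ?_) ?_
  · have := (hg t ht).1
    simpa using this
  · intro t ht u hu htu
    obtain ⟨h1, h2⟩ := (hg t ht).2
    obtain ⟨h3, h4⟩ := (hg u hu).2
    rw [htu, ← h4] at h2
    simpa using σ.2.1 h2

/-- Lower tail of the degree of a vertex, once the matching number is large. -/
theorem Pr_degreeOf_le {n : ℕ} (v : Fin n) {lam p d D K : ℝ} (hlam : lam ≤ 0) (hp0 : 0 ≤ p)
    (hp1 : p ≤ 1) (hpd : p * (n*(n-1)/2 : ℕ) ≤ d - 1 - D) {a b : ℕ} (hab : a ≤ b)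
    (hb : b ≤ n*(n-1)/2) :
    Pr n (fun σ => d ≤ matchNum (KonigProc σ a) ∧
      hits (fun _ _ => starEdges v Finset.univ) 0 b σ ≤ D ∧ degreeOf (KonigProc σ b) v ≤ K) ≤
      Real.exp (-(lam * K) + (Real.exp lam - 1) * p * (b - a)) := by
  set A : ℕ → EdgeOrdering n → Finset (Sym2 (Fin n)) := fun t σ =>
    if d ≤ matchNum (KonigProc σ t) ∧ hits (fun _ _ => starEdges v Finset.univ) 0 t σ ≤ D
    then starEdges v (coverOf (KonigProc σ t)) else allEdges n with hAdef
  have hA : ∀ t σ τ, EdgeOrdering.Agree t σ τ → A t σ = A t τ := by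
    intro t σ τ h
    have h2 := hits_congr (A := fun _ _ => starEdges v Finset.univ) (fun _ _ _ _ => rfl)
      (a := 0) h
    simp only [hAdef, konigProc_congr h, h2]
  refine (Pr_mono ?_).trans (Pr_hits_le lam p K hA hab hb ?_)
  · rintro σ ⟨h1, h2, h3⟩
    refine mul_le_mul_of_nonpos_left (le_trans ?_ h3) hlam
    have := hits_star_le_degreeOf (A := A) (σ := σ) (a := a) (b := b) (v := v) ?_
    · exact_mod_cast this
    · intro t hat htb
      simp only [hAdef]
      rw [if_pos]
      constructor
      · refine h1.trans ?_
        exact_mod_cast matchNum_mono (konigProc_mono σ hat)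
      · refine le_trans ?_ h2
        exact_mod_cast hits_mono le_rfl htb.le fun _ _ _ => subset_rfl
  · intro t σ hat htb
    have hl : Real.exp lam - 1 ≤ 0 := by
      have := Real.exp_le_one_iff.2 hlam
      linarith
    refine mul_le_mul_of_nonpos_left ?_ hl
    have htN : (t : ℝ) ≤ ((n*(n-1)/2 : ℕ) : ℝ) := by exact_mod_cast (htb.trans_le hb).le
    have ht0 : (0:ℝ) ≤ t := Nat.cast_nonneg t
    simp only [hAdef]
    split_ifs with h
    · have h1 := card_le_remaining_add σ t (S := starEdges v (coverOf (KonigProc σ t)))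
        fun e he => not_isDiag_of_mem_starEdges he
      have h2 : hits (fun _ _ => starEdges v (coverOf (KonigProc σ t))) 0 t σ ≤
          hits (fun _ _ => starEdges v Finset.univ) 0 t σ :=
        hits_mono le_rfl le_rfl fun _ _ _ => starEdges_mono v (Finset.subset_univ _)
      have h3 := (isKonig_konigProc σ t).isMatchedCover_coverOf.card_eq
      have h4 := Finset.pred_card_le_card_erase (s := coverOf (KonigProc σ t)) (a := v)
      rw [card_starEdges] at h1
      have h5 : matchNum (KonigProc σ t) ≤
          (remaining σ t (starEdges v (coverOf (KonigProc σ t)))).card +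
          hits (fun _ _ => starEdges v Finset.univ) 0 t σ + 1 := by omega
      have h6 : (matchNum (KonigProc σ t) : ℝ) ≤
          (remaining σ t (starEdges v (coverOf (KonigProc σ t)))).card +
          hits (fun _ _ => starEdges v Finset.univ) 0 t σ + 1 := by exact_mod_cast h5
      have h7 := mul_nonneg hp0 ht0
      linarith [h.1, h.2]
    · have := sub_le_card_remaining_allEdges σ t
      nlinarith

/-- The pairs joining a value of `f` to a value of `g`. -/
def crossEdges {n s : ℕ} (f g : Fin s → Fin n) : Finset (Sym2 (Fin n)) :=
  Finset.univ.image fun q : Fin s × Fin s => s(f q.1, g q.2)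

theorem card_crossEdges_le {n s : ℕ} (f g : Fin s → Fin n) : (crossEdges f g).card ≤ s ^ 2 :=
  Finset.card_image_le.trans (by simp [sq])

theorem exists_fin_enumeration {n s : ℕ} (W : Finset (Fin n)) (hW : W.card ≤ s) (x : Fin n) :
    ∃ g : Fin s → Fin n, ∀ w ∈ W, ∃ i, g i = w := by
  refine ⟨fun i => if h : i.1 < W.card then (W.equivFin.symm ⟨i.1, h⟩).1 else x, ?_⟩
  intro w hw
  refine ⟨⟨(W.equivFin ⟨w, hw⟩).1, (W.equivFin ⟨w, hw⟩).2.trans_le hW⟩, ?_⟩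
  simp

theorem card_le_hits {n : ℕ} {σ : EdgeOrdering n} {m : ℕ} {E S : Finset (Sym2 (Fin n))}
    (hES : E ⊆ S) (hE : ∀ e ∈ E, ∃ i : Fin (n*(n-1)/2), i.1 < m ∧ σ.1 i = e) :
    E.card ≤ hits (fun _ _ => S) 0 m σ := by
  have hsub : E ⊆ ((Finset.univ.filter fun i : Fin (n*(n-1)/2) => i.1 < m ∧ σ.1 i ∈ S).image σ.1) := by
    intro e he
    obtain ⟨i, hi, rfl⟩ := hE e he
    exact Finset.mem_image_of_mem _ (by simp [hi, hES he])
  refine (Finset.card_le_card hsub).trans (Finset.card_image_le.trans ?_)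
  refine Finset.card_le_card_of_injOn (fun i => i.1) ?_ Fin.val_injective.injOn
  intro i hi
  have hmem := (Finset.mem_filter.1 (Finset.mem_coe.1 hi)).2
  simp only [Finset.coe_filter, Finset.mem_Ico, Set.mem_ofPred_eq, zero_le, true_and]
  exact ⟨hmem.1, i.2, hmem.2⟩

/-- Large minimum degree and the absence of small dense spots imply that small independent
sets expand. -/
theorem konigProc_expansion {n : ℕ} {σ : EdgeOrdering n} {t m s₀ : ℕ} (htm : t ≤ m) {K : ℝ}
    (exp_degree_le : ∀ v, K ≤ degreeOf (KonigProc σ t) v)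
    (hsparse : ∀ s, 1 ≤ s → s ≤ s₀ → ∀ f g : Fin s → Fin n,
      (hits (fun _ _ => crossEdges f g) 0 m σ : ℝ) < K * s)
    {S W : Finset (Fin n)} (hS : S.Nonempty) (hS₀ : S.card ≤ s₀) (hSW : Disjoint S W)
    (hN : ∀ x ∈ S, ∀ y, (KonigProc σ t).Adj x y → y ∈ W) : S.card ≤ W.card := by
  by_contra hlt
  push Not at hlt
  obtain ⟨x₀, _⟩ := hS
  obtain ⟨f, hf⟩ := exists_fin_enumeration S le_rfl x₀
  obtain ⟨g, hg⟩ := exists_fin_enumeration W hlt.le x₀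
  set P := S.sigma fun x => Finset.univ.filter fun w => (KonigProc σ t).Adj x w with hP
  have hPmem : ∀ q ∈ P, q.1 ∈ S ∧ (KonigProc σ t).Adj q.1 q.2 ∧ q.2 ∈ W := by
    intro q hq
    obtain ⟨h1, h2⟩ := Finset.mem_sigma.1 hq
    have h3 := (Finset.mem_filter.1 h2).2
    exact ⟨h1, h3, hN _ h1 _ h3⟩
  have hcard : (P.image fun q => s(q.1, q.2)).card = P.card := by
    refine Finset.card_image_of_injOn ?_
    rintro ⟨x, y⟩ hq ⟨x', y'⟩ hq' h
    have h1 := hPmem _ hq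
    have h2 := hPmem _ hq'
    have h' : s(x, y) = s(x', y') := h
    rcases Sym2.eq_iff.1 h' with ⟨rfl, rfl⟩ | ⟨rfl, rfl⟩
    · rfl
    · exact absurd h2.2.2 (Finset.disjoint_left.1 hSW h1.1)
  have hhits : P.card ≤ hits (fun _ _ => crossEdges f g) 0 m σ := by
    rw [← hcard]
    refine card_le_hits ?_ ?_
    · intro e he
      obtain ⟨q, hq, rfl⟩ := Finset.mem_image.1 he
      have h1 := hPmem _ hq
      obtain ⟨i, hi⟩ := hf _ h1.1
      obtain ⟨j, hj⟩ := hg _ h1.2.2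
      exact Finset.mem_image.2 ⟨(i, j), Finset.mem_univ _, by simp [hi, hj]⟩
    · intro e he
      obtain ⟨q, hq, rfl⟩ := Finset.mem_image.1 he
      obtain ⟨i, hi, hi'⟩ := exists_eq_of_mem_konigProc σ
        (show s(q.1, q.2) ∈ (KonigProc σ t).edgeSet from (hPmem _ hq).2.1)
      exact ⟨i, hi.trans_le htm, hi'⟩
  have hPcard : K * S.card ≤ P.card := by
    rw [hP, Finset.card_sigma, Nat.cast_sum, mul_comm, ← nsmul_eq_mul, ← Finset.sum_const]
    exact Finset.sum_le_sum fun x _ => exp_degree_le x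
  have hlast := hsparse S.card (Finset.card_pos.2 ⟨x₀, by assumption⟩) hS₀ f g
  have : (P.card : ℝ) ≤ hits (fun _ _ => crossEdges f g) 0 m σ := by exact_mod_cast hhits
  linarith

/-! ### Combining the estimates -/

/-- If the process has no perfect matching at time `m`, then one of several unlikely events
occurs. -/
theorem perfect_or_unlikely {k n m₀ m₁ m s₀ : ℕ} (hnk : n = 2 * k) (h₁ : m₁ ≤ m)
    {δ γ K : ℝ} (hγ : 0 < γ) (hδn : 1 ≤ δ * n) (hs₀ : γ * n / 2 ≤ s₀)
    (σ : EdgeOrdering n)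
    (hfail : ¬ ∃ M : Finset (Sym2 (Fin n)), IsMatchingOn (KonigProc σ m) M ∧
      ∀ v : Fin n, ∃ f ∈ M, v ∈ f) :
    (∀ t, 0 ≤ t → t < m₀ → δ ^ 2 * n ^ 2 ≤ (improving (KonigProc σ t)).card) ∨
    (∃ v ∈ (Finset.univ : Finset (Fin n)),
      δ * n ≤ hits (fun _ _ => starEdges v Finset.univ) 0 m σ) ∨
    (∃ v ∈ (Finset.univ : Finset (Fin n)), (1 / 2 - δ) * n ≤ matchNum (KonigProc σ m₀) ∧
      hits (fun _ _ => starEdges v Finset.univ) 0 m₁ σ ≤ δ * n ∧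
      degreeOf (KonigProc σ m₁) v ≤ K) ∨
    (∃ s ∈ Finset.Icc 1 s₀, ∃ q ∈ (Finset.univ : Finset ((Fin s → Fin n) × (Fin s → Fin n))),
      K * s ≤ hits (fun _ _ => crossEdges q.1 q.2) 0 m σ) ∨
    (∀ t, m₁ ≤ t → t < m → γ ^ 2 / 8 * n ^ 2 ≤ (improving (KonigProc σ t)).card) := by
  by_contra hcon
  simp only [not_or, not_exists, not_and, Finset.mem_univ, true_implies, not_le] at hcon
  obtain ⟨c1, c2, c3, c4, c5⟩ := hcon
  have hmatch : (1 / 2 - δ) * n ≤ matchNum (KonigProc σ m₀) := by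
    by_contra hlt
    push Not at hlt
    apply c1
    intro t _ ht
    have hmt : (matchNum (KonigProc σ t) : ℝ) ≤ matchNum (KonigProc σ m₀) := by
      exact_mod_cast matchNum_mono (konigProc_mono σ ht.le)
    have h1 := (isKonig_konigProc σ t).unmatched_le_improving
    have h2 := two_mul_matchNum_le (KonigProc σ t)
    set u := n - 2 * matchNum (KonigProc σ t) with hu
    have hu' : (u : ℝ) = n - 2 * matchNum (KonigProc σ t) := by
      rw [hu, Nat.cast_sub h2]
      push_cast
      ring
    have h3 : u * u ≤ 2 * (improving (KonigProc σ t)).card + u := by omega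
    have h4 : (u : ℝ) * u ≤ 2 * (improving (KonigProc σ t)).card + u := by exact_mod_cast h3
    have h5 : 2 * (δ * n) ≤ u := by rw [hu']; linarith
    nlinarith
  have hsmall : ∀ v, (hits (fun _ _ => starEdges v Finset.univ) 0 m₁ σ : ℝ) ≤ δ * n := by
    intro v
    refine le_trans ?_ (c2 v).le
    exact_mod_cast hits_mono le_rfl h₁ fun _ _ _ => subset_rfl
  have exp_degree_le : ∀ v, K ≤ degreeOf (KonigProc σ m₁) v := fun v => (c3 v hmatch (hsmall v)).le
  apply c5
  intro t ht₁ htm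
  have hnot : 2 * matchNum (KonigProc σ t) + 2 ≤ n := by
    by_contra hlt
    have h1 := matchNum_mono (konigProc_mono σ htm.le)
    exact hfail (exists_perfect_of_le_matchNum (by omega))
  have hdegt : ∀ v, K ≤ degreeOf (KonigProc σ t) v := by
    intro v
    refine (exp_degree_le v).trans ?_
    norm_cast
    refine Finset.card_le_card fun w hw => ?_
    simp only [Finset.mem_filter, Finset.mem_univ, true_and] at hw ⊢
    exact konigProc_mono σ ht₁ hw
  have h1 := (isKonig_konigProc σ t).sq_le_improving hnot (s₀ := s₀)
    fun S W h2 h3 h4 h5 => konigProc_expansion htm.le hdegt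
      (fun s hs hs' f g => c4 s (Finset.mem_Icc.2 ⟨hs, hs'⟩) (f, g)) h2 h3 h4 h5
  have h6 : (s₀ : ℝ) * s₀ ≤ 2 * (improving (KonigProc σ t)).card := by exact_mod_cast h1
  have h7 : 0 ≤ γ * n / 2 := by positivity
  nlinarith

theorem Pr_high_degree_le {n m : ℕ} {δ B : ℝ} (hn : 0 < n)
    (hm : (n : ℝ) ^ 2 / 8 ≤ (n*(n-1)/2 : ℕ) - m) (hmB : (m : ℝ) ≤ B * n) :
    Pr n (fun σ => ∃ v ∈ (Finset.univ : Finset (Fin n)),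
      δ * n ≤ hits (fun _ _ => starEdges v Finset.univ) 0 m σ) ≤
      n * Real.exp (-(δ * n) + 24 * B) := by
  have hnpos : (0:ℝ) < n := by exact_mod_cast hn
  refine (Pr_exists_le _ _).trans ?_
  refine (Finset.sum_le_card_nsmul _ _ (Real.exp (-(δ * n) + 24 * B)) ?_).trans (by simp)
  intro v _
  have hS : ((starEdges v Finset.univ).card : ℝ) ≤ n := by
    rw [card_starEdges]
    exact_mod_cast (Finset.card_le_univ _).trans (by simp)
  have h := Pr_static_hits_le (lam := 1) zero_le_one (δ * n) _ hn hm hS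
  simp only [one_mul] at h
  refine h.trans (Real.exp_le_exp.2 ?_)
  have he : Real.exp 1 ≤ 3 := by linarith [Real.exp_one_lt_d9]
  have h1 : Real.exp 1 * (8 * n / n ^ 2) * m = Real.exp 1 * (8 * (m / n)) := by
    field_simp
  have h2 : (m : ℝ) / n ≤ B := by rwa [div_le_iff₀ hnpos]
  have h3 : (0:ℝ) ≤ m / n := by positivity
  rw [h1]
  nlinarith [Real.exp_pos 1]

theorem Pr_dense_le {n m s₀ : ℕ} {η γ B : ℝ} (hn : 0 < n)
    (hm : (n : ℝ) ^ 2 / 8 ≤ (n*(n-1)/2 : ℕ) - m)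
    (hmB : (m : ℝ) ≤ B * Real.log n * n) (hγ0 : 0 < γ) (hγ1 : γ ≤ 1)
    (hη : 8 * B + 4 ≤ -(Real.log γ) * η) (hs₀ : (s₀ : ℝ) ≤ γ * n) :
    Pr n (fun σ => ∃ s ∈ Finset.Icc 1 s₀,
      ∃ q ∈ (Finset.univ : Finset ((Fin s → Fin n) × (Fin s → Fin n))),
        η * Real.log n * s ≤ hits (fun _ _ => crossEdges q.1 q.2) 0 m σ) ≤
      Real.exp (-Real.log n) := by
  have hnpos : (0:ℝ) < n := by exact_mod_cast hn
  have hL : 0 ≤ Real.log n := Real.log_natCast_nonneg n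
  have hlam : 0 ≤ -Real.log γ := by
    have := Real.log_nonpos hγ0.le hγ1
    linarith
  have hsingle : ∀ s ∈ Finset.Icc 1 s₀, ∀ q : (Fin s → Fin n) × (Fin s → Fin n),
      Pr n (fun σ => η * Real.log n * s ≤ hits (fun _ _ => crossEdges q.1 q.2) 0 m σ) ≤
        Real.exp (-(4 * s * Real.log n)) := by
    intro s hs q
    have hs' : (s : ℝ) ≤ γ * n := by
      refine le_trans ?_ hs₀
      exact_mod_cast (Finset.mem_Icc.1 hs).2
    have hS : ((crossEdges q.1 q.2).card : ℝ) ≤ (s : ℝ) ^ 2 := by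
      exact_mod_cast card_crossEdges_le q.1 q.2
    have h := Pr_static_hits_le hlam (η * Real.log n * s) _ hn hm hS
    refine (Pr_mono fun σ hσ => mul_le_mul_of_nonneg_left hσ hlam).trans
      (h.trans (Real.exp_le_exp.2 ?_))
    rw [Real.exp_neg, Real.exp_log hγ0]
    have hs0 : (0:ℝ) ≤ s := Nat.cast_nonneg s
    have h1 : γ⁻¹ * (8 * (s:ℝ) ^ 2 / n ^ 2) * m ≤ 8 * B * Real.log n * s := by
      have e1 : γ⁻¹ * (8 * (s:ℝ) ^ 2 / n ^ 2) * m = 8 * s * ((s / (γ * n)) * (m / n)) := by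
        field_simp
      have e2 : (s:ℝ) / (γ * n) ≤ 1 := by rw [div_le_one (by positivity)]; exact hs'
      have e3 : (m:ℝ) / n ≤ B * Real.log n := by rwa [div_le_iff₀ hnpos]
      have e4 : (0:ℝ) ≤ m / n := by positivity
      have e5 : (s / (γ * n)) * ((m:ℝ) / n) ≤ B * Real.log n :=
        (mul_le_of_le_one_left e4 e2).trans e3
      rw [e1]
      calc 8 * (s:ℝ) * _ ≤ 8 * s * (B * Real.log n) :=
            mul_le_mul_of_nonneg_left e5 (by positivity)
        _ = _ := by ring
    have h2 := mul_le_mul_of_nonneg_right hη (mul_nonneg hL hs0)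
    nlinarith
  refine (Pr_exists_le _ _).trans ?_
  have hterm : ∀ s ∈ Finset.Icc 1 s₀,
      Pr n (fun σ => ∃ q ∈ (Finset.univ : Finset ((Fin s → Fin n) × (Fin s → Fin n))),
        η * Real.log n * s ≤ hits (fun _ _ => crossEdges q.1 q.2) 0 m σ) ≤
        Real.exp (-(2 * Real.log n)) := by
    intro s hs
    refine (Pr_exists_le _ _).trans ?_
    refine (Finset.sum_le_card_nsmul _ _ _ fun q _ => hsingle s hs q).trans ?_
    have hs1 : (1:ℝ) ≤ s := by exact_mod_cast (Finset.mem_Icc.1 hs).1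
    have hcard : ((Finset.univ : Finset ((Fin s → Fin n) × (Fin s → Fin n))).card : ℝ) =
        Real.exp (2 * s * Real.log n) := by
      rw [Finset.card_univ, Fintype.card_prod]
      simp only [Fintype.card_fun, Fintype.card_fin]
      push_cast
      rw [mul_assoc, two_mul, Real.exp_add, Real.exp_nat_mul, Real.exp_log hnpos]
    rw [nsmul_eq_mul, hcard, ← Real.exp_add]
    refine Real.exp_le_exp.2 ?_
    nlinarith
  refine (Finset.sum_le_card_nsmul _ _ _ hterm).trans ?_
  rw [Nat.card_Icc, nsmul_eq_mul, Nat.add_sub_cancel]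
  have hsn : (s₀ : ℝ) ≤ Real.exp (Real.log n) := by
    rw [Real.exp_log hnpos]
    nlinarith
  calc (s₀:ℝ) * Real.exp (-(2 * Real.log n))
      ≤ Real.exp (Real.log n) * Real.exp (-(2 * Real.log n)) := by gcongr
    _ = Real.exp (-Real.log n) := by rw [← Real.exp_add]; ring_nf

theorem Pr_low_degree_le {n m₀ m₁ : ℕ} {ε δ η : ℝ} (hn : 0 < n) (hδ0 : 0 < δ)
    (hδε : 7 * δ * (1 + ε / 2) ≤ ε / 4) (hδ1 : 7 * δ ≤ 1) (hδn : 1 ≤ δ * n)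
    (hη : -(Real.log δ) * η ≤ ε / 8) (h₀₁ : m₀ ≤ m₁) (hm₁ : m₁ ≤ n*(n-1)/2)
    (hlen : (1 + ε / 2) * n * Real.log n - 1 ≤ (m₁ : ℝ) - m₀) :
    Pr n (fun σ => ∃ v ∈ (Finset.univ : Finset (Fin n)),
      (1 / 2 - δ) * n ≤ matchNum (KonigProc σ m₀) ∧
      hits (fun _ _ => starEdges v Finset.univ) 0 m₁ σ ≤ δ * n ∧
      degreeOf (KonigProc σ m₁) v ≤ η * Real.log n) ≤
      Real.exp (1 - ε / 8 * Real.log n) := by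
  have hnpos : (0:ℝ) < n := by exact_mod_cast hn
  have hn1 : (1:ℝ) ≤ n := by exact_mod_cast hn
  have hL : 0 ≤ Real.log n := Real.log_natCast_nonneg n
  have hlogδ : Real.log δ ≤ 0 := Real.log_nonpos hδ0.le (by linarith)
  have hp1 : (1 - 6 * δ) / n ≤ 1 := by
    rw [div_le_one hnpos]
    linarith
  have hp0 : 0 ≤ (1 - 6 * δ) / n := div_nonneg (by linarith) hnpos.le
  have hpd : (1 - 6 * δ) / n * (n*(n-1)/2 : ℕ) ≤ (1 / 2 - δ) * n - 1 - δ * n := by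
    rw [cast_numEdges]
    have : (1 - 6 * δ) / n * ((n:ℝ) * (n - 1) / 2) = (1 - 6 * δ) * (n - 1) / 2 := by
      field_simp
    rw [this]
    nlinarith
  refine (Pr_exists_le _ _).trans ?_
  refine (Finset.sum_le_card_nsmul _ _ _ fun v _ =>
    Pr_degreeOf_le v hlogδ hp0 hp1 hpd h₀₁ hm₁).trans ?_
  rw [Finset.card_univ, Fintype.card_fin, nsmul_eq_mul, Real.exp_log hδ0]
  nth_rewrite 1 [← Real.exp_log hnpos]
  rw [← Real.exp_add]
  refine Real.exp_le_exp.2 ?_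
  have h1 : (1 - 7 * δ) * ((1 + ε / 2) * Real.log n - 1 / n) ≤
      (1 - δ) * ((1 - 6 * δ) / n) * ((m₁:ℝ) - m₀) := by
    have e1 : (1 + ε / 2) * Real.log n - 1 / n ≤ ((m₁:ℝ) - m₀) / n := by
      rw [le_div_iff₀ hnpos]
      have : ((1 + ε / 2) * Real.log n - 1 / n) * n = (1 + ε / 2) * n * Real.log n - 1 := by
        field_simp
      linarith
    have e2 : (0:ℝ) ≤ ((m₁:ℝ) - m₀) / n :=
      div_nonneg (sub_nonneg.2 (by exact_mod_cast h₀₁)) hnpos.le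
    calc _ ≤ (1 - 7 * δ) * (((m₁:ℝ) - m₀) / n) :=
          mul_le_mul_of_nonneg_left e1 (by linarith)
      _ ≤ ((1 - δ) * (1 - 6 * δ)) * (((m₁:ℝ) - m₀) / n) :=
          mul_le_mul_of_nonneg_right (by nlinarith) e2
      _ = _ := by ring
  have h2 : 1 / (n:ℝ) ≤ 1 := by rw [div_le_one hnpos]; exact hn1
  have h3 : 0 ≤ 1 / (n:ℝ) := by positivity
  have h4 := mul_le_mul_of_nonneg_right hη hL
  have h5 := mul_le_mul_of_nonneg_right hδε hL
  nlinarith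

theorem Pr_le_one {n : ℕ} (E : EdgeOrdering n → Prop) : Pr n E ≤ 1 := by
  rw [Pr_eq_card_filter]
  refine div_le_one_of_le₀ ?_ (Nat.cast_nonneg _)
  exact_mod_cast Finset.card_le_univ _

theorem Pr_add_Pr_not {n : ℕ} (E : EdgeOrdering n → Prop) :
    Pr n E + Pr n (fun σ => ¬ E σ) = 1 := by
  rw [Pr_eq_card_filter, Pr_eq_card_filter, ← add_div]
  have h : ((Fintype.card (EdgeOrdering n) : ℕ) : ℝ) ≠ 0 := by
    exact_mod_cast Fintype.card_ne_zero
  rw [div_eq_one_iff_eq h]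
  norm_cast
  rw [← Finset.card_univ]
  convert Finset.card_filter_add_card_filter_not (s := Finset.univ) E

/-- An explicit lower bound for the probability of a perfect matching, for large `n`. -/
theorem one_sub_le_Pr_perfect {k n : ℕ} (hnk : n = 2 * k) {ε δ γ η : ℝ} (hε : 0 < ε)
    (hδ0 : 0 < δ) (hδ1 : 7 * δ ≤ 1) (hδε : 7 * δ * (1 + ε / 2) ≤ ε / 4)
    (hη : -(Real.log δ) * η ≤ ε / 8) (hη' : 8 * (2 + ε) + 4 ≤ -(Real.log γ) * η)
    (hγ0 : 0 < γ) (hγ1 : γ ≤ 1)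
    (e1 : (2 + ε) * Real.log n ≤ γ ^ 2 * δ ^ 2 / 16 * n)
    (e2 : (1 + 24 * (2 + ε)) * Real.log n ≤ δ / 2 * n)
    (e3 : 1 ≤ δ * n) (e4 : 2 ≤ γ * n) (e5 : 1 ≤ Real.log n) (e6 : 8 ≤ δ ^ 2 * ε * Real.log n)
    (e7 : 64 ≤ γ ^ 2 * ε * Real.log n) (e8 : 2 ≤ n) :
    1 - (Real.exp (0 - 1 / 2 * n) + (Real.exp (0 - δ / 2 * n) +
      (Real.exp (1 - ε / 8 * Real.log n) + (Real.exp (0 - 1 * Real.log n) +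
      Real.exp (1 - 1 / 2 * n))))) ≤
    Pr n (fun σ => ∃ M : Finset (Sym2 (Fin n)),
      IsMatchingOn (KonigProc σ ⌈(1 + ε) * n * Real.log n⌉₊) M ∧
        ∀ v : Fin n, ∃ f ∈ M, v ∈ f) := by
  have hn : 0 < n := by omega
  have hn2 : (2:ℝ) ≤ n := by exact_mod_cast e8
  have hnpos : (0:ℝ) < n := by linarith
  set L := Real.log n with hL
  have hnL : 2 ≤ n * L := by
    have := mul_le_mul_of_nonneg_left e5 hnpos.le
    linarith
  have hnLpos : 0 < n * L := by linarith
  set m₀ := ⌈ε / 4 * n * L⌉₊ with hm₀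
  set m₁ := ⌈(1 + 3 * ε / 4) * n * L⌉₊ with hm₁
  set m := ⌈(1 + ε) * n * L⌉₊ with hm
  set s₀ := ⌊γ * n⌋₊ with hs₀
  have a1 : ε / 4 * n * L ≤ m₀ := Nat.le_ceil _
  have a2 : (m₀ : ℝ) < ε / 4 * n * L + 1 := Nat.ceil_lt_add_one (by positivity)
  have b1 : (1 + 3 * ε / 4) * n * L ≤ m₁ := Nat.le_ceil _
  have b2 : (m₁ : ℝ) < (1 + 3 * ε / 4) * n * L + 1 := Nat.ceil_lt_add_one (by positivity)
  have c1 : (1 + ε) * n * L ≤ m := Nat.le_ceil _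
  have c2 : (m : ℝ) < (1 + ε) * n * L + 1 := Nat.ceil_lt_add_one (by positivity)
  have hεnL : 0 < ε * (n * L) := by positivity
  have h₀₁ : m₀ ≤ m₁ := Nat.ceil_mono (by linarith)
  have h₁ : m₁ ≤ m := Nat.ceil_mono (by linarith)
  have h₀₁' : (m₀ : ℝ) ≤ m₁ := by exact_mod_cast h₀₁
  have h₁' : (m₁ : ℝ) ≤ m := by exact_mod_cast h₁
  have hmB : (m : ℝ) ≤ (2 + ε) * L * n := by linarith
  have hmsq : (m : ℝ) ≤ γ ^ 2 * δ ^ 2 / 16 * n ^ 2 := by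
    have := mul_le_mul_of_nonneg_right e1 hnpos.le
    linarith
  have hγ2 : γ ^ 2 ≤ 1 := pow_le_one₀ hγ0.le hγ1
  have hδ2 : δ ^ 2 ≤ 1 := pow_le_one₀ hδ0.le (by linarith)
  have hγ2' : 0 < γ ^ 2 := by positivity
  have hδ2' : 0 < δ ^ 2 := by positivity
  have hn2pos : 0 < (n:ℝ) ^ 2 := by positivity
  have hmγ : (m : ℝ) ≤ γ ^ 2 / 8 * n ^ 2 / 2 := by
    have : γ ^ 2 * δ ^ 2 ≤ γ ^ 2 := mul_le_of_le_one_right hγ2'.le hδ2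
    have := mul_le_mul_of_nonneg_right this hn2pos.le
    linarith
  have hmδ : (m : ℝ) ≤ δ ^ 2 * n ^ 2 / 2 := by
    have : γ ^ 2 * δ ^ 2 ≤ δ ^ 2 := mul_le_of_le_one_left hδ2'.le hγ2
    have := mul_le_mul_of_nonneg_right this hn2pos.le
    have := mul_pos hδ2' hn2pos
    linarith
  have hmN' : (n : ℝ) ^ 2 / 8 ≤ (n*(n-1)/2 : ℕ) - m := by
    rw [cast_numEdges]
    have := mul_le_mul_of_nonneg_right hγ2 hn2pos.le
    have := mul_le_mul_of_nonneg_left hn2 hnpos.le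
    linarith
  have hmN : m ≤ n*(n-1)/2 := by
    have : (m:ℝ) ≤ (n*(n-1)/2 : ℕ) := by linarith
    exact_mod_cast this
  have hs₀le : (s₀ : ℝ) ≤ γ * n := Nat.floor_le (by positivity)
  have hs₀ge : γ * n / 2 ≤ s₀ := by
    have := Nat.lt_floor_add_one (γ * n)
    linarith
  have many_early := Pr_many_improving_le (n := n) hδ2'.le hδ2 (Nat.zero_le m₀) (h₀₁.trans (h₁.trans hmN))
    ((h₀₁'.trans h₁').trans hmδ)
  have high_degree := Pr_high_degree_le (δ := δ) hn hmN' hmB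
  have low_degree := Pr_low_degree_le hn hδ0 hδε hδ1 e3 hη h₀₁ (h₁.trans hmN)
    (by rw [← hL]; linarith)
  have dense := Pr_dense_le hn hmN' hmB hγ0 hγ1 hη' hs₀le
  have many_late := Pr_many_improving_le (n := n) (q := γ ^ 2 / 8) (by positivity) (by linarith) h₁ hmN
    hmγ
  have exp_early_le : Real.exp (n / 2 - δ ^ 2 / 2 * (m₀ - (0 : ℕ))) ≤ Real.exp (0 - 1 / 2 * n) := by
    refine Real.exp_le_exp.2 ?_
    have h1 : δ ^ 2 * (ε / 4 * n * L) ≤ δ ^ 2 * m₀ := mul_le_mul_of_nonneg_left a1 hδ2'.le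
    have h2 := mul_le_mul_of_nonneg_right e6 hnpos.le
    push_cast
    linarith
  have exp_degree_le : n * Real.exp (-(δ * n) + 24 * ((2 + ε) * L)) ≤ Real.exp (0 - δ / 2 * n) := by
    nth_rewrite 1 [← Real.exp_log hnpos]
    rw [← Real.exp_add]
    refine Real.exp_le_exp.2 ?_
    linarith
  have exp_late_le : Real.exp (n / 2 - γ ^ 2 / 8 / 2 * (m - m₁)) ≤ Real.exp (1 - 1 / 2 * n) := by
    refine Real.exp_le_exp.2 ?_
    have h1 : ε / 4 * n * L - 1 ≤ (m:ℝ) - m₁ := by linarith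
    have h2 := mul_le_mul_of_nonneg_left h1 hγ2'.le
    have h3 := mul_le_mul_of_nonneg_right e7 hnpos.le
    linarith
  have hlog : Real.exp (-L) = Real.exp (0 - 1 * L) := by congr 1; ring
  rw [hlog] at dense
  rw [sub_le_iff_le_add]
  refine (Pr_add_Pr_not (n := n) (fun σ => ∃ M : Finset (Sym2 (Fin n)),
      IsMatchingOn (KonigProc σ m) M ∧ ∀ v : Fin n, ∃ f ∈ M, v ∈ f)).ge.trans ?_
  refine add_le_add le_rfl ?_
  refine (Pr_mono fun σ hσ => perfect_or_unlikely (K := η * L) (m₀ := m₀) hnk h₁ hγ0 e3 hs₀ge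
    σ hσ).trans ?_
  refine (Pr_or_le _ _).trans (add_le_add (many_early.trans exp_early_le) ?_)
  refine (Pr_or_le _ _).trans (add_le_add (high_degree.trans exp_degree_le) ?_)
  refine (Pr_or_le _ _).trans (add_le_add low_degree ?_)
  exact (Pr_or_le _ _).trans (add_le_add dense (many_late.trans exp_late_le))

/-- For every ε > 0, whp the graph `G_m` of the König process with `m = ⌈(1+ε) n log n⌉`
contains a perfect matching (a matching covering all vertices). -/
theorem koenig_process_perfect_matching (ε : ℝ) (hε : 0 < ε) :
    Filter.Tendsto (fun k : ℕ =>
      Pr (2*k) (fun σ =>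
        ∃ M : Finset (Sym2 (Fin (2*k))),
          IsMatchingOn (KonigProc σ ⌈(1+ε) * (2*k) * Real.log (2*k)⌉₊) M ∧
          ∀ v : Fin (2*k), ∃ f ∈ M, v ∈ f))
      Filter.atTop (nhds 1) := by
  obtain ⟨δ, γ, η, hδ0, hδ1, hδε, hη, hη', hγ0, hγ1⟩ : ∃ δ γ η : ℝ, 0 < δ ∧ 7 * δ ≤ 1 ∧
      7 * δ * (1 + ε / 2) ≤ ε / 4 ∧ -(Real.log δ) * η ≤ ε / 8 ∧
      8 * (2 + ε) + 4 ≤ -(Real.log γ) * η ∧ 0 < γ ∧ γ ≤ 1 := by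
    have hδ0 : 0 < ε / (28 * (1 + ε)) := by positivity
    have hδ1 : 7 * (ε / (28 * (1 + ε))) < 1 := by
      rw [← mul_div_assoc, div_lt_one (by positivity)]
      linarith
    have hδε : 7 * (ε / (28 * (1 + ε))) * (1 + ε / 2) ≤ ε / 4 := by
      rw [← mul_div_assoc, div_mul_eq_mul_div, div_le_iff₀ (by positivity)]
      nlinarith
    have hlog : 0 < -Real.log (ε / (28 * (1 + ε))) := by
      have := Real.log_neg hδ0 (by linarith)
      linarith
    set η := ε / 8 / -Real.log (ε / (28 * (1 + ε))) with hη
    have hη0 : 0 < η := by positivity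
    refine ⟨_, Real.exp (-((8 * (2 + ε) + 4) / η)), η, hδ0, hδ1.le, hδε, ?_, ?_,
      Real.exp_pos _, ?_⟩
    · rw [hη, mul_div_cancel₀ _ hlog.ne']
    · rw [Real.log_exp, neg_neg, div_mul_cancel₀ _ hη0.ne']
    · rw [Real.exp_le_one_iff, neg_nonpos]
      positivity
  have hn : Filter.Tendsto (fun k : ℕ => ((2 * k : ℕ) : ℝ)) Filter.atTop Filter.atTop :=
    tendsto_natCast_atTop_atTop.comp
      (Filter.tendsto_id.const_mul_atTop' (by norm_num : 0 < 2))
  have hlog := Real.tendsto_log_atTop.comp hn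
  have hsmall : ∀ c : ℝ, 0 < c → ∀ᶠ k : ℕ in Filter.atTop,
      Real.log ((2 * k : ℕ) : ℝ) ≤ c * ((2 * k : ℕ) : ℝ) := by
    intro c hc
    filter_upwards [hn.eventually (Real.isLittleO_log_id_atTop.bound hc)] with k hk
    rw [Real.norm_eq_abs, id, Real.norm_eq_abs,
      abs_of_nonneg (Nat.cast_nonneg (2 * k) : (0 : ℝ) ≤ ((2 * k : ℕ) : ℝ))] at hk
    exact (le_abs_self _).trans hk
  have hexp : ∀ (u : ℕ → ℝ) (a b : ℝ), 0 < a → Filter.Tendsto u Filter.atTop Filter.atTop →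
      Filter.Tendsto (fun k => Real.exp (b - a * u k)) Filter.atTop (nhds 0) := by
    intro u a b ha hu
    refine Real.tendsto_exp_atBot.comp ?_
    exact Filter.tendsto_atBot_add_const_left _ b
      (Filter.tendsto_neg_atTop_atBot.comp (hu.const_mul_atTop ha))
  have hbound : Filter.Tendsto (fun k : ℕ => 1 -
      (Real.exp (0 - 1 / 2 * ((2 * k : ℕ) : ℝ)) +
      (Real.exp (0 - δ / 2 * ((2 * k : ℕ) : ℝ)) +
      (Real.exp (1 - ε / 8 * Real.log ((2 * k : ℕ) : ℝ)) +
      (Real.exp (0 - 1 * Real.log ((2 * k : ℕ) : ℝ)) +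
      Real.exp (1 - 1 / 2 * ((2 * k : ℕ) : ℝ))))))) Filter.atTop (nhds 1) := by
    have := (((hexp _ (1/2) 0 (by norm_num) hn).add ((hexp _ (δ/2) 0 (by positivity) hn).add
      ((hexp _ (ε/8) 1 (by positivity) hlog).add ((hexp _ 1 0 one_pos hlog).add
      (hexp _ (1/2) 1 (by norm_num) hn)))))).const_sub 1
    simpa using this
  refine tendsto_of_tendsto_of_tendsto_of_le_of_le' hbound tendsto_const_nhds ?_
    (Filter.Eventually.of_forall fun k => Pr_le_one _)
  filter_upwards [hsmall (γ ^ 2 * δ ^ 2 / (16 * (2 + ε))) (by positivity),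
    hsmall (δ / (2 * (1 + 24 * (2 + ε)))) (by positivity),
    hn.eventually_ge_atTop (1 / δ), hn.eventually_ge_atTop (2 / γ),
    hlog.eventually_ge_atTop 1, hlog.eventually_ge_atTop (8 / (δ ^ 2 * ε)),
    hlog.eventually_ge_atTop (64 / (γ ^ 2 * ε)), hn.eventually_ge_atTop 2]
    with k e1 e2 e3 e4 e5 e6 e7 e8
  simp only [Function.comp] at e5 e6 e7
  have hm : ⌈(1+ε) * (2*k) * Real.log (2*k)⌉₊ =
      ⌈(1+ε) * (2*k : ℕ) * Real.log (2*k : ℕ)⌉₊ := by push_cast; rfl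
  rw [hm]
  refine one_sub_le_Pr_perfect rfl hε hδ0 hδ1 hδε hη hη' hγ0 hγ1 ?_ ?_ ?_ ?_ e5 ?_ ?_
    (by exact_mod_cast e8)
  · calc (2 + ε) * Real.log ((2 * k : ℕ) : ℝ) ≤ (2 + ε) * _ :=
          mul_le_mul_of_nonneg_left e1 (by positivity)
      _ = _ := by field_simp
  · calc (1 + 24 * (2 + ε)) * Real.log ((2 * k : ℕ) : ℝ) ≤ (1 + 24 * (2 + ε)) * _ :=
          mul_le_mul_of_nonneg_left e2 (by positivity)
      _ = _ := by field_simp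
  · rwa [div_le_iff₀' hδ0] at e3
  · rwa [div_le_iff₀' hγ0] at e4
  · rwa [div_le_iff₀' (by positivity)] at e6
  · rwa [div_le_iff₀' (by positivity)] at e7
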